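/- Let k be a field of characteristic zero and let d₂ be a simple derivation of R₂ = k[x₁,x₂] satisfying: (i) if d₂(r) = g(x₂) with r ∈ R₂, g ∈ k[x₂], deg g ≤ l, then r ∈ k and g = 0; (ii) some exponent matrix A_{d₂} of d₂ satisfies condition (∗). Let n > 2 and d_n = d₂ + g₂(x₂)∂_{x₃} + … + g_{n-1}(x_{n-1})∂_{x_n} with g_j ∈ k[x_j] \ k and deg_{x₂} g₂ ≤ l. Then d_n is a simple derivation of k[x₁,…,x_n] and Aut(k[x₁,…,x_n])_{d_n} = { (x₁,…,x_{n-1}, x_n + c) : c ∈ k }. -/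

import Mathlib

open MvPolynomial

/-- A derivation is simple when its only stable ideals are trivial. -/
def DSimple {k R : Type*} [CommSemiring k] [CommRing R] [Algebra k R] (d : Derivation k R R) :
    Prop :=
  ∀ I : Ideal R, (∀ f ∈ I, d f ∈ I) → I = ⊥ ∨ I = ⊤

/-- No nonconstant element has derivative in `k g + k`, and `k g + k` is otherwise direct. -/
def NoPrimitive {k R : Type*} [CommSemiring k] [CommRing R] [Algebra k R] (d : Derivation k R R)
    (g : R) : Prop :=
  ∀ (r : R) (c c' : k), d r = algebraMap k R c * g + algebraMap k R c' →
    c = 0 ∧ c' = 0 ∧ ∃ e : k, r = algebraMap k R e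

section NoPrimitiveBasic

variable {k R : Type*} [Field k] [CommRing R] [Algebra k R] {d : Derivation k R R} {g : R}

theorem NoPrimitive.algebraMap_injective (h : NoPrimitive d g) :
    Function.Injective (algebraMap k R) := by
  rw [injective_iff_map_eq_zero]
  intro a ha
  exact (h 0 0 a (by simp [ha])).2.1

theorem NoPrimitive.const (h : NoPrimitive d g) {r : R} {c : k} (hr : d r = algebraMap k R c) :
    c = 0 ∧ ∃ e : k, r = algebraMap k R e :=
  (h r 0 c (by simp [hr])).2

end NoPrimitiveBasic

section PolynomialExtension

variable {k R : Type*} [Field k] [CommRing R] [Algebra k R]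
  {d : Derivation k R R} {g : R} {D : Derivation k (Polynomial R) (Polynomial R)}

theorem coeff_extension (hC : ∀ r, D (Polynomial.C r) = Polynomial.C (d r))
    (hX : D Polynomial.X = Polynomial.C g) (p : Polynomial R) (i : ℕ) :
    (D p).coeff i = d (p.coeff i) + (i + 1 : ℕ) * g * p.coeff (i + 1) := by
  have key : ∀ (n : ℕ) (a : R), D (Polynomial.C a * Polynomial.X ^ n)
      = Polynomial.C (d a) * Polynomial.X ^ n
        + Polynomial.C a * ((n : Polynomial R) * Polynomial.X ^ (n - 1) * Polynomial.C g) := by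
    intro n a
    rw [Derivation.leibniz, hC, Derivation.leibniz_pow, hX]
    simp only [smul_eq_mul, nsmul_eq_mul]
    ring
  induction p using Polynomial.induction_on' with
  | add p q hp hq =>
    simp only [map_add, Polynomial.coeff_add, hp, hq]
    ring
  | monomial n a =>
    rw [← Polynomial.C_mul_X_pow_eq_monomial, key]
    rcases n with _ | n
    · simp [Polynomial.coeff_C]
      split_ifs <;> simp
    · have : (Polynomial.C a * (((n + 1 : ℕ) : Polynomial R) * Polynomial.X ^ (n + 1 - 1)
          * Polynomial.C g)) = Polynomial.C (a * (n + 1 : ℕ) * g) * Polynomial.X ^ n := by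
        simp only [Polynomial.C_mul, Nat.add_sub_cancel, map_natCast]
        ring
      rw [this]
      simp only [Polynomial.coeff_add, Polynomial.coeff_C_mul_X_pow, add_left_inj]
      by_cases h : i = n
      · subst h; simp; ring
      · rw [if_neg h]; split_ifs <;> simp

variable [CharZero k]

theorem DSimple.extension (hd : DSimple d) (hg : ∀ r, d r ≠ g)
    (hC : ∀ r, D (Polynomial.C r) = Polynomial.C (d r))
    (hX : D Polynomial.X = Polynomial.C g) : DSimple D := by
  intro I hI
  by_cases hbot : I = ⊥
  · exact Or.inl hbot
  right
  obtain ⟨f₀, hf₀, hf₀0⟩ := Submodule.exists_mem_ne_zero_of_ne_bot hbot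
  have hex : ∃ n, ∃ f ∈ I, f ≠ 0 ∧ f.natDegree = n := ⟨_, f₀, hf₀, hf₀0, rfl⟩
  classical
  set n := Nat.find hex with hn
  obtain ⟨f₁, hf₁, hf₁0, hf₁n⟩ := Nat.find_spec hex
  have hmin : ∀ f ∈ I, f.natDegree < n → f = 0 := by
    intro f hf hlt
    by_contra h0
    exact Nat.find_min hex hlt ⟨f, hf, h0, rfl⟩
  let J : Ideal R :=
    { carrier := {a | ∃ f ∈ I, f.natDegree ≤ n ∧ f.coeff n = a}
      zero_mem' := ⟨0, I.zero_mem, by simp, by simp⟩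
      add_mem' := by
        rintro a b ⟨f, hf, hfn, rfl⟩ ⟨f', hf', hfn', rfl⟩
        exact ⟨f + f', I.add_mem hf hf', (Polynomial.natDegree_add_le _ _).trans (max_le hfn hfn'),
          by simp⟩
      smul_mem' := by
        rintro c a ⟨f, hf, hfn, rfl⟩
        exact ⟨Polynomial.C c * f, I.mul_mem_left _ hf,
          (Polynomial.natDegree_C_mul_le _ _).trans hfn, by simp⟩ }
  have hdeg : ∀ f : Polynomial R, f.natDegree ≤ n → (D f).natDegree ≤ n := by
    intro f hf
    rw [Polynomial.natDegree_le_iff_coeff_eq_zero]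
    intro N hN
    rw [coeff_extension hC hX, Polynomial.coeff_eq_zero_of_natDegree_lt (by lia),
      Polynomial.coeff_eq_zero_of_natDegree_lt (by lia)]
    simp
  have hco : ∀ f : Polynomial R, f.natDegree ≤ n → (D f).coeff n = d (f.coeff n) := by
    intro f hf
    rw [coeff_extension hC hX, Polynomial.coeff_eq_zero_of_natDegree_lt (n := n + 1) (by lia)]
    simp
  have hJ : J = ⊤ := by
    refine (hd J ?_).resolve_left ?_
    · rintro a ⟨f, hf, hfn, rfl⟩
      exact ⟨D f, hI f hf, hdeg f hfn, hco f hfn⟩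
    · intro hJ
      have : f₁.coeff n ∈ J := ⟨f₁, hf₁, hf₁n.le, rfl⟩
      rw [hJ, Submodule.mem_bot, hn, ← hf₁n] at this
      exact hf₁0 (Polynomial.leadingCoeff_eq_zero.mp this)
  obtain ⟨f, hf, hfn, hf1⟩ : (1 : R) ∈ J := by rw [hJ]; trivial
  have hDf : D f = 0 := by
    by_contra hne
    have hle := hdeg f hfn
    have h0 : (D f).coeff n = 0 := by rw [hco f hfn, hf1]; simp
    rcases hle.lt_or_eq with h | h
    · exact hne (hmin _ (hI f hf) h)
    · apply hne
      rw [← h] at h0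
      exact Polynomial.leadingCoeff_eq_zero.mp h0
  rcases Nat.eq_zero_or_pos n with h0 | hpos
  · rw [h0] at hf1 hfn
    rw [Polynomial.eq_C_of_natDegree_le_zero hfn, hf1, Polynomial.C_1] at hf
    exact (Ideal.eq_top_iff_one _).mpr hf
  · exfalso
    have h := coeff_extension hC hX f (n - 1)
    rw [hDf, Nat.sub_add_cancel hpos, hf1, Polynomial.coeff_zero, mul_one] at h
    apply hg (-((n : k)⁻¹ • f.coeff (n - 1)))
    rw [map_neg, Derivation.map_smul, eq_neg_of_add_eq_zero_left h.symm, smul_neg, neg_neg,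
      ← nsmul_eq_mul, ← Nat.cast_smul_eq_nsmul k, smul_smul, inv_mul_cancel₀, one_smul]
    exact_mod_cast hpos.ne'

theorem NoPrimitive.ne (h : NoPrimitive d g) (r : R) : d r ≠ g := fun hr =>
  one_ne_zero (h r 1 0 (by simp [hr])).1

/-- The subleading coefficient of an element of degree at least one cannot be killed. -/
theorem NoPrimitive.natDegree_eq_zero_aux (h : NoPrimitive d g)
    (hC : ∀ r, D (Polynomial.C r) = Polynomial.C (d r))
    (hX : D Polynomial.X = Polynomial.C g) {r : Polynomial R} {c c' : k}
    (hpos : 0 < r.natDegree) (h1 : (D r).coeff r.natDegree = algebraMap k R c)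
    (h2 : (D r).coeff (r.natDegree - 1) = algebraMap k R c') : False := by
  rw [coeff_extension hC hX, Polynomial.coeff_eq_zero_of_natDegree_lt (n := r.natDegree + 1)
    (by lia), mul_zero, add_zero] at h1
  obtain ⟨-, e, he⟩ := h.const h1
  rw [coeff_extension hC hX, Nat.sub_add_cancel hpos, he] at h2
  have := (h (r.coeff (r.natDegree - 1)) (-(r.natDegree * e)) c' (by
    rw [← h2]; simp; ring)).1
  have he0 : e = 0 := by
    have hn : (r.natDegree : k) ≠ 0 := by exact_mod_cast hpos.ne'
    simpa [hn, hpos.ne'] using this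
  rw [he0, map_zero] at he
  have := Polynomial.leadingCoeff_eq_zero.mp he
  simp [this] at hpos

theorem NoPrimitive.extension_eq (h : NoPrimitive d g)
    (hC : ∀ r, D (Polynomial.C r) = Polynomial.C (d r))
    (hX : D Polynomial.X = Polynomial.C g) {r : Polynomial R} {p : Polynomial k}
    (hr : D r = p.map (algebraMap k R)) :
    (∃ e : k, r = Polynomial.C (algebraMap k R e)) ∧ p = 0 := by
  have h0 : r.natDegree = 0 := by
    by_contra hne
    exact h.natDegree_eq_zero_aux hC hX (Nat.pos_of_ne_zero hne) (c := p.coeff r.natDegree)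
      (c' := p.coeff (r.natDegree - 1)) (by rw [hr, Polynomial.coeff_map])
      (by rw [hr, Polynomial.coeff_map])
  obtain ⟨r₀, rfl⟩ := Polynomial.natDegree_eq_zero.mp h0
  rw [hC] at hr
  have h1 : d r₀ = algebraMap k R (p.coeff 0) := by
    rw [← Polynomial.coeff_map, ← hr, Polynomial.coeff_C_zero]
  obtain ⟨-, e, he⟩ := h.const h1
  refine ⟨⟨e, by rw [he]⟩, ?_⟩
  apply Polynomial.map_injective _ h.algebraMap_injective
  rw [← hr, he]
  simp

theorem NoPrimitive.extension (h : NoPrimitive d g)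
    (hC : ∀ r, D (Polynomial.C r) = Polynomial.C (d r))
    (hX : D Polynomial.X = Polynomial.C g) {G : Polynomial k} (hG : 0 < G.natDegree) :
    NoPrimitive D (G.map (algebraMap k R)) := by
  intro r c c' hr
  have := h.extension_eq hC hX (r := r) (p := Polynomial.C c * G + Polynomial.C c') (by
    rw [hr]; simp [Polynomial.algebraMap_apply])
  obtain ⟨⟨e, he⟩, h0⟩ := this
  have hc : c = 0 := by
    by_contra hc
    have : (Polynomial.C c * G + Polynomial.C c').natDegree = G.natDegree := by
      rw [Polynomial.natDegree_add_C, Polynomial.natDegree_C_mul hc]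
    rw [h0] at this
    simp at this; lia
  refine ⟨hc, ?_, e, by rw [he, Polynomial.algebraMap_apply]⟩
  simpa [hc] using h0

theorem NoPrimitive.extension_eq_C (h : NoPrimitive d g)
    (hC : ∀ r, D (Polynomial.C r) = Polynomial.C (d r))
    (hX : D Polynomial.X = Polynomial.C g) {r : Polynomial R} {q : R}
    (hr : D r = Polynomial.C q) :
    ∃ (c : k) (r₀ : R), r = Polynomial.C (algebraMap k R c) * Polynomial.X + Polynomial.C r₀ ∧
      d r₀ = q - algebraMap k R c * g := by
  have h1 : r.natDegree ≤ 1 := by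
    by_contra! hne
    refine h.natDegree_eq_zero_aux hC hX (r := r) (c := 0) (c' := 0) (by lia) ?_ ?_
    · rw [hr, Polynomial.coeff_C, if_neg (by lia), map_zero]
    · rw [hr, Polynomial.coeff_C, if_neg (by lia), map_zero]
  have e1 := coeff_extension hC hX r 1
  have e0 := coeff_extension hC hX r 0
  rw [hr, Polynomial.coeff_eq_zero_of_natDegree_lt (n := 1 + 1) (by lia), mul_zero, add_zero,
    Polynomial.coeff_C, if_neg one_ne_zero] at e1
  obtain ⟨-, c, hc⟩ := h.const (c := 0) (r := r.coeff 1) (by rw [← e1, map_zero])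
  rw [hr, Polynomial.coeff_C_zero, zero_add, hc] at e0
  refine ⟨c, r.coeff 0, ?_, ?_⟩
  · conv_lhs => rw [Polynomial.eq_X_add_C_of_natDegree_le_one h1]
    rw [hc]
  · rw [e0]; simp; ring

end PolynomialExtension

section Transfer

variable {k R S : Type*} [Field k] [CommRing R] [Algebra k R] [CommRing S] [Algebra k S]

/-- Transport of a derivation along an isomorphism. -/
def Derivation.conj (e : R ≃ₐ[k] S) (d : Derivation k R R) : Derivation k S S :=
  Derivation.mk' (e.toLinearMap ∘ₗ d.toLinearMap ∘ₗ e.symm.toLinearMap) (by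
    intro a b
    simp)

@[simp] theorem Derivation.conj_apply (e : R ≃ₐ[k] S) (d : Derivation k R R) (s : S) :
    d.conj e s = e (d (e.symm s)) := rfl

theorem DSimple.conj {d : Derivation k R R} (hd : DSimple d) (e : R ≃ₐ[k] S) :
    DSimple (d.conj e) := by
  intro I hI
  rcases hd (I.comap (e : R →+* S)) (by
    intro f hf
    have := hI _ (Ideal.mem_comap.mp hf)
    simpa [Ideal.mem_comap] using this) with h | h
  · left
    rw [eq_bot_iff]
    intro s hs
    have : e.symm s ∈ I.comap (e : R →+* S) := by simpa [Ideal.mem_comap] using hs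
    rw [h, Submodule.mem_bot] at this
    simpa using this
  · right
    rw [Ideal.eq_top_iff_one] at h ⊢
    simpa [Ideal.mem_comap] using h

theorem NoPrimitive.conj {d : Derivation k R R} {g : R} (hd : NoPrimitive d g) (e : R ≃ₐ[k] S) :
    NoPrimitive (d.conj e) (e g) := by
  intro r c c' hr
  obtain ⟨h1, h2, e', he⟩ := hd (e.symm r) c c' (by
    apply e.injective
    simpa using hr)
  refine ⟨h1, h2, e', ?_⟩
  apply e.symm.injective
  simpa using he

/-- An element of a ring with a simple derivation dividing its derivative is zero or a unit. -/
theorem DSimple.isUnit_of_dvd {d : Derivation k R R} (hd : DSimple d) {h : R} (h0 : h ≠ 0)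
    (hdvd : h ∣ d h) : IsUnit h := by
  rw [← Ideal.span_singleton_eq_top]
  refine (hd _ ?_).resolve_left (by simpa using h0)
  intro f hf
  rw [Ideal.mem_span_singleton] at hf ⊢
  obtain ⟨q, rfl⟩ := hf
  rw [Derivation.leibniz]
  exact dvd_add (dvd_mul_right _ _) (hdvd.mul_left _)

theorem DSimple.injective {d : Derivation k R R} {D : Derivation k S S} [Nontrivial S]
    (hd : DSimple d) (f : R →ₐ[k] S) (hf : ∀ r, f (d r) = D (f r)) : Function.Injective f := by
  rw [RingHom.injective_iff_ker_eq_bot]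
  refine (hd (RingHom.ker f) ?_).resolve_right (RingHom.ker_ne_top f)
  intro r hr
  rw [RingHom.mem_ker] at hr ⊢
  rw [hf, hr, map_zero]

end Transfer

section TwoVariables

variable {k S σ : Type*} [Field k] [CommRing S] [Algebra k S]

theorem MvPolynomial.equivariant_of_X {φ : MvPolynomial σ k →ₐ[k] S}
    {d : Derivation k (MvPolynomial σ k) (MvPolynomial σ k)} {D : Derivation k S S}
    (h : ∀ i, φ (d (X i)) = D (φ (X i))) (f : MvPolynomial σ k) : φ (d f) = D (φ f) := by
  induction f using MvPolynomial.induction_on with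
  | C a =>
    rw [← algebraMap_eq, AlgHom.commutes, Derivation.map_algebraMap, Derivation.map_algebraMap,
      map_zero]
  | add p q hp hq => simp only [map_add, hp, hq]
  | mul_X p i hp =>
    simp only [Derivation.leibniz, map_mul, map_add, hp, h, smul_eq_mul]

theorem MvPolynomial.derivation_algHom_fin_two (φ : MvPolynomial (Fin 2) k →ₐ[k] S)
    (D : Derivation k S S) (f : MvPolynomial (Fin 2) k) :
    D (φ f) = φ (pderiv 0 f) * D (φ (X 0)) + φ (pderiv 1 f) * D (φ (X 1)) := by
  induction f using MvPolynomial.induction_on with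
  | C a =>
    rw [← algebraMap_eq, AlgHom.commutes, Derivation.map_algebraMap, Derivation.map_algebraMap,
      Derivation.map_algebraMap]
    simp
  | add p q hp hq => simp only [map_add, hp, hq]; ring
  | mul_X p i hp =>
    simp only [Derivation.leibniz, map_mul, map_add, hp, smul_eq_mul, pderiv_X]
    fin_cases i <;> simp <;> ring

theorem MvPolynomial.derivation_fin_two
    (d : Derivation k (MvPolynomial (Fin 2) k) (MvPolynomial (Fin 2) k))
    (f : MvPolynomial (Fin 2) k) :
    d f = pderiv 0 f * d (X 0) + pderiv 1 f * d (X 1) :=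
  derivation_algHom_fin_two (AlgHom.id k _) d f

theorem MvPolynomial.pderiv_comm (i j : σ) (f : MvPolynomial σ k) :
    pderiv i (pderiv j f) = pderiv j (pderiv i f) := by
  have : ⁅(pderiv i : Derivation k (MvPolynomial σ k) (MvPolynomial σ k)), (pderiv j : Derivation k (MvPolynomial σ k) (MvPolynomial σ k))⁆ = 0 := by
    apply derivation_ext
    intro l
    classical
    simp [Derivation.commutator_apply, pderiv_X, Pi.single_apply, apply_ite (pderiv _)]
  have h := congrArg (fun D => D f) this
  simpa [Derivation.commutator_apply, sub_eq_zero] using h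

/-- Formal antiderivative in the variable `i`. -/
noncomputable def MvPolynomial.antideriv (k : Type*) [Field k] {σ : Type*} (i : σ) :
    MvPolynomial σ k →ₗ[k] MvPolynomial σ k :=
  (basisMonomials σ k).constr k
    fun m => monomial (m + Finsupp.single i 1) (((m i : k) + 1)⁻¹)

theorem MvPolynomial.antideriv_monomial (i : σ) (m : σ →₀ ℕ) (c : k) :
    antideriv k i (monomial m c) = monomial (m + Finsupp.single i 1) (c * ((m i : k) + 1)⁻¹) := by
  have h1 : monomial m c = c • (basisMonomials σ k m) := by simp [smul_monomial]
  rw [h1, map_smul, antideriv, Module.Basis.constr_basis, smul_monomial, smul_eq_mul]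

theorem MvPolynomial.pderiv_antideriv [CharZero k] (i : σ) (f : MvPolynomial σ k) :
    pderiv i (antideriv k i f) = f := by
  induction f using MvPolynomial.monomial_add_induction_on with
  | C a =>
    have : (C a : MvPolynomial σ k) = monomial 0 a := rfl
    rw [this, antideriv_monomial, pderiv_monomial]; simp
  | monomial_add m c f _ _ hf =>
    have h0 : ((m i : k) + 1) ≠ 0 := by exact_mod_cast Nat.succ_ne_zero (m i)
    rw [map_add, map_add, hf, antideriv_monomial, pderiv_monomial]
    simp [h0]

theorem MvPolynomial.pderiv_antideriv_comm {i j : σ} (hij : i ≠ j) (f : MvPolynomial σ k) :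
    pderiv j (antideriv k i f) = antideriv k i (pderiv j f) := by
  induction f using MvPolynomial.monomial_add_induction_on with
  | C a =>
    have : (C a : MvPolynomial σ k) = monomial 0 a := rfl
    rw [this, antideriv_monomial, pderiv_monomial]; simp [hij]
  | monomial_add m c f _ _ hf =>
    simp only [map_add, hf, antideriv_monomial, pderiv_monomial, add_left_inj]
    by_cases hm : m j = 0
    · simp [hm, hij]
    · have : m + Finsupp.single i 1 - Finsupp.single j 1
          = m - Finsupp.single j 1 + Finsupp.single i 1 := by
        ext l
        by_cases hl : l = j
        · subst hl; simp [hij]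
        · simp [Ne.symm hl]
      rw [this]
      simp [hij, Ne.symm hij]
      congr 1
      ring

variable {d : Derivation k (MvPolynomial (Fin 2) k) (MvPolynomial (Fin 2) k)}

theorem exists_potential [CharZero k] (hdiv : pderiv 0 (d (X 0)) + pderiv 1 (d (X 1)) = 0) :
    ∃ F, pderiv 1 F = d (X 0) ∧ pderiv 0 F = - d (X 1) := by
  set F₁ := antideriv k 1 (d (X 0)) with hF₁
  refine ⟨F₁ + antideriv k 0 (- d (X 1) - pderiv 0 F₁), ?_, ?_⟩
  · rw [map_add, hF₁, pderiv_antideriv, pderiv_antideriv_comm (by decide), map_sub, ← hF₁,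
      pderiv_comm 1 0, hF₁, pderiv_antideriv, map_neg,
      ← eq_neg_of_add_eq_zero_left hdiv]
    simp
  · rw [map_add, pderiv_antideriv]; ring

/-- Only constants have constant derivative. -/
def ConstPrimitive {k R : Type*} [CommSemiring k] [CommRing R] [Algebra k R]
    (d : Derivation k R R) : Prop :=
  ∀ (f : R) (c : k), d f = algebraMap k R c → ∃ e : k, f = algebraMap k R e

theorem X_ne_C (i : σ) (e : k) : (X i : MvPolynomial σ k) ≠ C e := by
  intro h
  have := congrArg totalDegree h
  simp at this

theorem ConstPrimitive.divergence_ne_zero [CharZero k] (hc : ConstPrimitive d) :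
    pderiv 0 (d (X 0)) + pderiv 1 (d (X 1)) ≠ 0 := by
  intro hdiv
  obtain ⟨F, h1, h0⟩ := exists_potential hdiv
  obtain ⟨e, rfl⟩ := hc F 0 (by rw [derivation_fin_two, h1, h0]; simp; ring)
  rw [algebraMap_eq, pderiv_C] at h1
  obtain ⟨e, he⟩ := hc (X 0) 0 (by rw [← h1, map_zero])
  exact X_ne_C _ _ he

variable [CharZero k] [IsDomain S] {D : Derivation k S S} {ι : MvPolynomial (Fin 2) k →ₐ[k] S}

theorem linearized_solution (hd : DSimple d) (hc : ConstPrimitive d) (hD : DSimple D)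
    (hS : ∀ s : S, IsUnit s → ∃ c : k, s = algebraMap k S c) (hι : ∀ f, ι (d f) = D (ι f))
    {u v : S} (hu : D u = ι (pderiv 0 (d (X 0))) * u + ι (pderiv 1 (d (X 0))) * v)
    (hv : D v = ι (pderiv 0 (d (X 1))) * u + ι (pderiv 1 (d (X 1))) * v) :
    ∃ c : k, u = algebraMap k S c * ι (d (X 0)) ∧ v = algebraMap k S c * ι (d (X 1)) := by
  have hinj := hd.injective ι hι
  have ha := derivation_fin_two d (d (X 0))
  have hb := derivation_fin_two d (d (X 1))
  set a := d (X 0) with hadef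
  set b := d (X 1) with hbdef
  have hDa : D (ι a) = ι (pderiv 0 a) * ι a + ι (pderiv 1 a) * ι b := by
    rw [← hι, ha]; simp
  have hDb : D (ι b) = ι (pderiv 0 b) * ι a + ι (pderiv 1 b) * ι b := by
    rw [← hι, hb]; simp
  by_cases hJ : ι a * v - ι b * u = 0
  · have hne : ¬ (a = 0 ∧ b = 0) := by
      rintro ⟨h, -⟩
      obtain ⟨e, he⟩ := hc (X 0) 0 (by rw [← hadef, h, map_zero])
      exact X_ne_C _ _ he
    have htop : Ideal.span {a, b} = ⊤ := by
      refine (hd _ ?_).resolve_left ?_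
      · intro f _
        rw [Ideal.mem_span_pair]
        exact ⟨_, _, (derivation_fin_two d f).symm⟩
      · intro h
        rw [Ideal.span_eq_bot] at h
        exact hne ⟨h a (by simp), h b (by simp)⟩
    obtain ⟨p, q, hpq⟩ := Ideal.mem_span_pair.mp ((Ideal.eq_top_iff_one _).mp htop)
    have hpq' : ι p * ι a + ι q * ι b = 1 := by rw [← map_mul, ← map_mul, ← map_add, hpq, map_one]
    set h := ι p * u + ι q * v with hh
    have hu' : u = ι a * h := by
      rw [hh]; linear_combination (-u) * hpq' - ι q * hJ
    have hv' : v = ι b * h := by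
      rw [hh]; linear_combination (-v) * hpq' + ι p * hJ
    have e1 : ι a * D h = 0 := by
      have := hu
      rw [hu', hv', Derivation.leibniz, hDa] at this
      simp only [smul_eq_mul] at this
      linear_combination this
    have e2 : ι b * D h = 0 := by
      have := hv
      rw [hu', hv', Derivation.leibniz, hDb] at this
      simp only [smul_eq_mul] at this
      linear_combination this
    have hDh : D h = 0 := by linear_combination (-D h) * hpq' + ι p * e1 + ι q * e2
    obtain ⟨c, hc⟩ : ∃ c : k, h = algebraMap k S c := by
      by_cases h0 : h = 0
      · exact ⟨0, by simp [h0]⟩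
      · exact hS h (hD.isUnit_of_dvd h0 (by rw [hDh]; exact dvd_zero _))
    exact ⟨c, by rw [← hc, mul_comm]; exact hu', by rw [← hc, mul_comm]; exact hv'⟩
  · exfalso
    have hDJ : D (ι a * v - ι b * u) = ι (pderiv 0 a + pderiv 1 b) * (ι a * v - ι b * u) := by
      rw [map_sub, Derivation.leibniz, Derivation.leibniz, hDa, hDb, hu, hv, map_add]
      simp only [smul_eq_mul]
      ring
    obtain ⟨c, hc'⟩ := hS _ (hD.isUnit_of_dvd hJ (by rw [hDJ]; exact dvd_mul_left _ _))
    have h0 : D (ι a * v - ι b * u) = 0 := by rw [hc', Derivation.map_algebraMap]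
    rw [h0, zero_eq_mul, or_iff_left hJ, map_eq_zero_iff _ hinj] at hDJ
    exact hc.divergence_ne_zero hDJ

end TwoVariables

section Tower

variable {k : Type*} [Field k]

/-- Polynomials in `m + 1` variables as univariate polynomials in the last variable. -/
noncomputable def MvPolynomial.lastEquiv (k : Type*) [Field k] (m : ℕ) :
    MvPolynomial (Fin (m + 1)) k ≃ₐ[k] Polynomial (MvPolynomial (Fin m) k) :=
  (renameEquiv k finSuccEquivLast).trans (optionEquivLeft k (Fin m))

@[simp] theorem MvPolynomial.lastEquiv_X_last (m : ℕ) :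
    lastEquiv k m (X (Fin.last m)) = Polynomial.X := by
  simp [lastEquiv, optionEquivLeft_X_none]

@[simp] theorem MvPolynomial.lastEquiv_rename (m : ℕ) (f : MvPolynomial (Fin m) k) :
    lastEquiv k m (rename Fin.castSucc f) = Polynomial.C f := by
  have : ((lastEquiv k m).toAlgHom.comp (rename Fin.castSucc))
      = (Algebra.ofId (MvPolynomial (Fin m) k) _).restrictScalars k := by
    apply algHom_ext
    intro i
    simp [lastEquiv, optionEquivLeft_X_some, Algebra.ofId_apply]
  exact congrArg (fun φ => φ f) this

theorem MvPolynomial.lastEquiv_symm_C (m : ℕ) (f : MvPolynomial (Fin m) k) :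
    (lastEquiv k m).symm (Polynomial.C f) = rename Fin.castSucc f := by
  rw [AlgEquiv.symm_apply_eq, lastEquiv_rename]

theorem MvPolynomial.lastEquiv_symm_X (m : ℕ) :
    (lastEquiv k m).symm Polynomial.X = X (Fin.last m) := by
  rw [AlgEquiv.symm_apply_eq, lastEquiv_X_last]

theorem MvPolynomial.lastEquiv_aeval_last (m : ℕ) (p : Polynomial k) :
    lastEquiv k m (Polynomial.aeval (X (Fin.last m)) p) = p.map (algebraMap k _) := by
  rw [← Polynomial.aeval_algHom_apply, lastEquiv_X_last, ← Polynomial.aeval_map_algebraMap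
    (MvPolynomial (Fin m) k), Polynomial.aeval_X_left_apply]

theorem MvPolynomial.pderiv_last_rename (m : ℕ) (f : MvPolynomial (Fin m) k) :
    pderiv (Fin.last m) (rename Fin.castSucc f) = 0 := by
  induction f using MvPolynomial.induction_on with
  | C a => simp
  | add p q hp hq => simp [hp, hq]
  | mul_X p i hp =>
    rw [map_mul, Derivation.leibniz, hp, rename_X, pderiv_X_of_ne (Fin.castSucc_lt_last i).ne]
    simp

theorem MvPolynomial.lastEquiv_pderiv_last (m : ℕ) (f : MvPolynomial (Fin (m + 1)) k) :
    lastEquiv k m (pderiv (Fin.last m) f) = Polynomial.derivative (lastEquiv k m f) := by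
  have := MvPolynomial.equivariant_of_X (φ := (lastEquiv k m).toAlgHom)
    (d := pderiv (Fin.last m)) (D := (Polynomial.derivative' :
      Derivation (MvPolynomial (Fin m) k) _ _).restrictScalars k) (by
      intro i
      induction i using Fin.lastCases with
      | last => simp [Polynomial.derivative'_apply]
      | cast i =>
        have : (X (Fin.castSucc i) : MvPolynomial (Fin (m + 1)) k)
          = rename Fin.castSucc (X i) := by simp
        rw [this, pderiv_last_rename]
        simp [-rename_X]) f
  simpa [Polynomial.derivative'_apply] using this

theorem MvPolynomial.pderiv_last_eq_zero [CharZero k] (m : ℕ) {f : MvPolynomial (Fin (m + 1)) k}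
    (hf : pderiv (Fin.last m) f = 0) : ∃ g, f = rename Fin.castSucc g := by
  have h1 := lastEquiv_pderiv_last m f
  rw [hf, map_zero] at h1
  have h2 := Polynomial.derivative_eq_zero.mp h1.symm
  obtain ⟨g, hg⟩ := Polynomial.natDegree_eq_zero.mp h2
  exact ⟨g, by rw [← lastEquiv_symm_C, hg, AlgEquiv.symm_apply_apply]⟩

theorem MvPolynomial.exists_iterate_pderiv_last_eq_zero (m : ℕ)
    (f : MvPolynomial (Fin (m + 1)) k) : ∃ N, (pderiv (Fin.last m))^[N] f = 0 := by
  have h : ∀ N, lastEquiv k m ((pderiv (Fin.last m))^[N] f)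
      = Polynomial.derivative^[N] (lastEquiv k m f) := by
    intro N
    induction N with
    | zero => rfl
    | succ N ih =>
      rw [Function.iterate_succ_apply', lastEquiv_pderiv_last, ih, Function.iterate_succ_apply']
  refine ⟨(lastEquiv k m f).natDegree + 1, ?_⟩
  apply (lastEquiv k m).injective
  rw [h, map_zero]
  exact Polynomial.iterate_derivative_eq_zero (Nat.lt_succ_self _)

variable (d : Derivation k (MvPolynomial (Fin 2) k) (MvPolynomial (Fin 2) k))
  (G : ℕ → Polynomial k)

/-- The derivation `d + ∑ G j (x_{j-1}) ∂_j` in `m + 2` variables. -/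
noncomputable def towerDer (m : ℕ) :
    Derivation k (MvPolynomial (Fin (m + 2)) k) (MvPolynomial (Fin (m + 2)) k) :=
  mkDerivation k fun j =>
    if h : (j : ℕ) < 2 then rename (Fin.castLE (Nat.le_add_left 2 m)) (d (X ⟨j, h⟩))
    else Polynomial.aeval (X ⟨j - 1, by have := j.2; lia⟩) (G j)

theorem towerDer_zero : towerDer d G 0 = d := by
  apply derivation_ext
  intro i
  have : (Fin.castLE (Nat.le_add_left 2 0)) = (id : Fin 2 → Fin 2) := by ext; simp
  rw [towerDer, mkDerivation_X, dif_pos i.2, this]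
  simp

theorem towerDer_X (m i : ℕ) (h2 : 2 ≤ i) (hi : i < m + 2) :
    towerDer d G m (X ⟨i, hi⟩) = Polynomial.aeval (X ⟨i - 1, by lia⟩) (G i) := by
  rw [towerDer, mkDerivation_X, dif_neg (by simp; lia)]

theorem towerDer_X_last (m : ℕ) : towerDer d G (m + 1) (X (Fin.last (m + 2)))
    = rename Fin.castSucc (Polynomial.aeval (X (Fin.last (m + 1))) (G (m + 2))) := by
  rw [towerDer, mkDerivation_X, dif_neg (by simp), ← Polynomial.aeval_algHom_apply, rename_X]
  rfl

theorem towerDer_rename (m : ℕ) (f : MvPolynomial (Fin (m + 2)) k) :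
    rename Fin.castSucc (towerDer d G m f) = towerDer d G (m + 1) (rename Fin.castSucc f) := by
  apply equivariant_of_X
  intro i
  rw [rename_X, towerDer, towerDer, mkDerivation_X, mkDerivation_X]
  by_cases h : (i : ℕ) < 2
  · rw [dif_pos h, dif_pos (by simpa using h), rename_rename]
    rfl
  · rw [dif_neg h, dif_neg (by simpa using h), ← Polynomial.aeval_algHom_apply, rename_X]
    rfl

theorem towerDer_castLE (m : ℕ) (f : MvPolynomial (Fin 2) k) :
    rename (Fin.castLE (Nat.le_add_left 2 m)) (d f)
      = towerDer d G m (rename (Fin.castLE (Nat.le_add_left 2 m)) f) := by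
  apply equivariant_of_X
  intro i
  rw [rename_X, towerDer, mkDerivation_X, dif_pos (by simp; lia)]
  rfl

theorem towerDer_pderiv_last (m : ℕ) (f : MvPolynomial (Fin (m + 3)) k) :
    pderiv (Fin.last (m + 2)) (towerDer d G (m + 1) f)
      = towerDer d G (m + 1) (pderiv (Fin.last (m + 2)) f) := by
  have : ⁅(pderiv (Fin.last (m + 2)) : Derivation k (MvPolynomial (Fin (m + 3)) k) _),
      towerDer d G (m + 1)⁆ = 0 := by
    apply derivation_ext
    intro i
    rw [Derivation.commutator_apply]
    induction i using Fin.lastCases with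
    | last => rw [towerDer_X_last, pderiv_last_rename]; simp
    | cast i =>
      have : (X (Fin.castSucc i) : MvPolynomial (Fin (m + 3)) k)
        = rename Fin.castSucc (X i) := by simp
      rw [this, ← towerDer_rename, pderiv_last_rename, pderiv_last_rename]; simp
  have h := congrArg (fun D => D f) this
  simpa [Derivation.commutator_apply, sub_eq_zero] using h

theorem towerDer_conj_C (m : ℕ) (f : MvPolynomial (Fin (m + 2)) k) :
    (towerDer d G (m + 1)).conj (lastEquiv k (m + 2)) (Polynomial.C f)
      = Polynomial.C (towerDer d G m f) := by
  rw [Derivation.conj_apply, lastEquiv_symm_C, ← towerDer_rename, lastEquiv_rename]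

theorem towerDer_conj_X (m : ℕ) :
    (towerDer d G (m + 1)).conj (lastEquiv k (m + 2)) Polynomial.X
      = Polynomial.C (Polynomial.aeval (X (Fin.last (m + 1))) (G (m + 2))) := by
  rw [Derivation.conj_apply, lastEquiv_symm_X, towerDer_X_last, lastEquiv_rename]

variable {d G} [CharZero k]

theorem towerDer_noPrimitive (h0 : NoPrimitive d (Polynomial.aeval (X 1) (G 2)))
    (hG : ∀ j, 2 ≤ j → 0 < (G j).natDegree) (m : ℕ) :
    NoPrimitive (towerDer d G m) (Polynomial.aeval (X (Fin.last (m + 1))) (G (m + 2))) := by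
  induction m with
  | zero => rw [towerDer_zero]; exact h0
  | succ m ih =>
    have := (ih.extension (towerDer_conj_C d G m) (towerDer_conj_X d G m)
      (hG (m + 3) (by lia))).conj (lastEquiv k (m + 2)).symm
    rw [← lastEquiv_aeval_last, AlgEquiv.symm_apply_apply] at this
    convert this using 1
    ext f
    simp

theorem towerDer_simple (hd : DSimple d) (h0 : NoPrimitive d (Polynomial.aeval (X 1) (G 2)))
    (hG : ∀ j, 2 ≤ j → 0 < (G j).natDegree) (m : ℕ) : DSimple (towerDer d G m) := by
  induction m with
  | zero => rw [towerDer_zero]; exact hd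
  | succ m ih =>
    have := (ih.extension (towerDer_noPrimitive h0 hG m).ne (towerDer_conj_C d G m)
      (towerDer_conj_X d G m)).conj (lastEquiv k (m + 2)).symm
    convert this using 1
    ext f
    simp

theorem towerDer_eq_aeval_last (h0 : NoPrimitive d (Polynomial.aeval (X 1) (G 2)))
    (hG : ∀ j, 2 ≤ j → 0 < (G j).natDegree) (m : ℕ) {r : MvPolynomial (Fin (m + 3)) k}
    {p : Polynomial k} (hr : towerDer d G (m + 1) r = Polynomial.aeval (X (Fin.last (m + 2))) p) :
    (∃ e : k, r = C e) ∧ p = 0 := by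
  obtain ⟨⟨e, he⟩, hp⟩ := (towerDer_noPrimitive h0 hG m).extension_eq (towerDer_conj_C d G m)
    (towerDer_conj_X d G m) (r := lastEquiv k (m + 2) r) (p := p) (by
      rw [Derivation.conj_apply, AlgEquiv.symm_apply_apply, hr, lastEquiv_aeval_last])
  refine ⟨⟨e, ?_⟩, hp⟩
  rw [← AlgEquiv.symm_apply_apply (lastEquiv k (m + 2)) r, he, lastEquiv_symm_C, algebraMap_eq,
    rename_C]

theorem towerDer_eq_rename (h0 : NoPrimitive d (Polynomial.aeval (X 1) (G 2)))
    (hG : ∀ j, 2 ≤ j → 0 < (G j).natDegree) (m : ℕ) {r : MvPolynomial (Fin (m + 3)) k}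
    {q : MvPolynomial (Fin (m + 2)) k} (hr : towerDer d G (m + 1) r = rename Fin.castSucc q) :
    ∃ (c : k) (r₀ : MvPolynomial (Fin (m + 2)) k),
      r = C c * X (Fin.last (m + 2)) + rename Fin.castSucc r₀ ∧
      towerDer d G m r₀ = q - C c * Polynomial.aeval (X (Fin.last (m + 1))) (G (m + 2)) := by
  obtain ⟨c, r₀, hr₀, h⟩ := (towerDer_noPrimitive h0 hG m).extension_eq_C (towerDer_conj_C d G m)
    (towerDer_conj_X d G m) (r := lastEquiv k (m + 2) r) (q := q) (by
      rw [Derivation.conj_apply, AlgEquiv.symm_apply_apply, hr, lastEquiv_rename])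
  refine ⟨c, r₀, ?_, h⟩
  rw [← AlgEquiv.symm_apply_apply (lastEquiv k (m + 2)) r, hr₀, map_add, map_mul,
    lastEquiv_symm_C, lastEquiv_symm_C, lastEquiv_symm_X, algebraMap_eq, rename_C]

theorem towerDer_eq_aeval (h0 : NoPrimitive d (Polynomial.aeval (X 1) (G 2)))
    (hG : ∀ j, 2 ≤ j → 0 < (G j).natDegree) (m : ℕ) (i : Fin (m + 2)) (hi2 : 2 ≤ (i : ℕ))
    (him : (i : ℕ) + 1 < m + 2) {r : MvPolynomial (Fin (m + 2)) k} {p : Polynomial k}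
    (hp : p.natDegree < (G (i + 1)).natDegree)
    (hr : towerDer d G m r = Polynomial.aeval (X i) p) : p = 0 := by
  induction m with
  | zero => lia
  | succ m ih =>
    obtain ⟨i, rfl⟩ : ∃ i' : Fin (m + 2), i = Fin.castSucc i' := ⟨⟨i, by lia⟩, rfl⟩
    rw [← rename_X, Polynomial.aeval_algHom_apply] at hr
    obtain ⟨c, r₀, -, h⟩ := towerDer_eq_rename h0 hG m hr
    obtain ⟨m, rfl⟩ : ∃ m', m = m' + 1 := ⟨m - 1, by simp at hi2 him; lia⟩
    rw [← algebraMap_eq, ← Polynomial.aeval_C (X (Fin.last (m + 1 + 1))) c, ← map_mul] at h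
    by_cases hlast : i = Fin.last (m + 2)
    · subst hlast
      rw [← map_sub] at h
      have h1 := (towerDer_eq_aeval_last h0 hG m h).2
      simp only [Fin.val_castSucc, Fin.val_last] at hp
      by_contra hne
      rw [sub_eq_zero] at h1
      by_cases hc : c = 0
      · rw [hc] at h1; simp at h1; exact hne h1
      · rw [h1, Polynomial.natDegree_C_mul hc] at hp
        exact lt_irrefl _ hp
    · have hlt : (i : ℕ) < m + 2 := by
        have := i.2
        have h2 : (i : ℕ) ≠ m + 2 := fun h => hlast (Fin.ext h)
        lia
      obtain ⟨i, rfl⟩ : ∃ i' : Fin (m + 2), i = Fin.castSucc i' := ⟨⟨i, by lia⟩, rfl⟩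
      have h1 := congrArg (pderiv (Fin.last (m + 2))) h
      rw [towerDer_pderiv_last, map_sub, ← rename_X, Polynomial.aeval_algHom_apply,
        pderiv_last_rename, zero_sub] at h1
      have h2 : pderiv (Fin.last (m + 2))
          (Polynomial.aeval (X (Fin.last (m + 2)) : MvPolynomial (Fin (m + 3)) k)
            (Polynomial.C c * G (m + 3)))
          = Polynomial.aeval (X (Fin.last (m + 2))) (Polynomial.C c *
            Polynomial.derivative (G (m + 3))) := by
        have := Derivation.map_aeval (pderiv (Fin.last (m + 2)) :
          Derivation k (MvPolynomial (Fin (m + 3)) k) _) (Polynomial.C c * G (m + 3))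
          (X (Fin.last (m + 2)))
        rw [this]
        simp
      rw [h2, ← map_neg] at h1
      have h3 := (towerDer_eq_aeval_last h0 hG m h1).2
      have hc : c = 0 := by
        have hne : Polynomial.derivative (G (m + 3)) ≠ 0 := by
          intro h
          have := Polynomial.derivative_eq_zero.mp h
          have := hG (m + 3) (by lia)
          lia
        simpa [hne] using h3
      rw [hc] at h
      simp only [map_zero, zero_mul, sub_zero] at h
      exact ih (Fin.castSucc i) hi2 (by simp) hp h

end Tower

section Isotropy

theorem ConstPrimitive.of_iterate {k R : Type*} [CommSemiring k] [CommRing R] [Algebra k R]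
    {d : Derivation k R R} (hc : ConstPrimitive d) {N : ℕ} {f : R} (h : d^[N] f = 0) :
    ∃ e : k, f = algebraMap k R e := by
  induction N generalizing f with
  | zero => exact ⟨0, by simpa using h⟩
  | succ N ih =>
    obtain ⟨e, he⟩ := ih (f := d f) h
    exact hc f e he

theorem MvPolynomial.const_of_isUnit {k σ : Type*} [Field k] (s : MvPolynomial σ k)
    (hs : IsUnit s) : ∃ c : k, s = algebraMap k (MvPolynomial σ k) c := by
  rw [MvPolynomial.isUnit_iff_eq_C_of_isReduced] at hs
  obtain ⟨c, -, h⟩ := hs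
  exact ⟨c, h⟩

theorem Polynomial.natDegree_comp_X_add_C_sub_lt {k : Type*} [Field k] {p : Polynomial k} (hp : 0 < p.natDegree)
    (c : k) : (p.comp (Polynomial.X + Polynomial.C c) - p).natDegree < p.natDegree := by
  have hp0 : p ≠ 0 := by rintro rfl; simp at hp
  have hd : (p.comp (Polynomial.X + Polynomial.C c)).natDegree = p.natDegree := by
    rw [Polynomial.natDegree_comp, Polynomial.natDegree_X_add_C, mul_one]
  have hc0 : p.comp (Polynomial.X + Polynomial.C c) ≠ 0 := by
    intro h
    rw [h, Polynomial.natDegree_zero] at hd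
    lia
  have hdeg : (p.comp (Polynomial.X + Polynomial.C c)).degree = p.degree := by
    rw [Polynomial.degree_eq_natDegree hc0, Polynomial.degree_eq_natDegree hp0, hd]
  have hlt := Polynomial.degree_sub_lt_left hdeg hc0 (by
    rw [Polynomial.leadingCoeff_comp (by simp), Polynomial.leadingCoeff_X_add_C, one_pow, mul_one])
  by_cases h0 : p.comp (Polynomial.X + Polynomial.C c) - p = 0
  · rw [h0]; simpa using hp
  · rw [← hd]
    exact Polynomial.natDegree_lt_natDegree h0 hlt

variable {k : Type*} [Field k] [CharZero k]
  {d : Derivation k (MvPolynomial (Fin 2) k) (MvPolynomial (Fin 2) k)} {G : ℕ → Polynomial k}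
  {S : Type*} [CommRing S] [IsDomain S] [Algebra k S] {D : Derivation k S S}

theorem exists_factor_castLE (hd : DSimple d) (hc : ConstPrimitive d)
    (h0 : NoPrimitive d (Polynomial.aeval (X 1) (G 2))) (hG : ∀ j, 2 ≤ j → 0 < (G j).natDegree)
    (hD : DSimple D) (hS : ∀ s : S, IsUnit s → ∃ c : k, s = algebraMap k S c) (m : ℕ)
    (θ : MvPolynomial (Fin (m + 2)) k →ₐ[k] S) (hθ : ∀ f, θ (towerDer d G m f) = D (θ f))
    (ψ : MvPolynomial (Fin 2) k →ₐ[k] MvPolynomial (Fin (m + 2)) k)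
    (hψ : ∀ f, ψ (d f) = towerDer d G m (ψ f)) :
    ∃ ψ₀ : MvPolynomial (Fin 2) k →ₐ[k] MvPolynomial (Fin 2) k,
      ∀ f, ψ f = rename (Fin.castLE (Nat.le_add_left 2 m)) (ψ₀ f) := by
  induction m with
  | zero =>
    refine ⟨ψ, fun f => ?_⟩
    have : (Fin.castLE (Nat.le_add_left 2 0)) = (id : Fin 2 → Fin 2) := by ext; simp
    rw [this, rename_id_apply]
  | succ m ih =>
    have hθinj := (towerDer_simple hd h0 hG (m + 1)).injective θ hθ
    have hι : ∀ f, (θ.comp ψ) (d f) = D ((θ.comp ψ) f) := by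
      intro f
      simp [hψ, hθ]
    set δ : Derivation k (MvPolynomial (Fin (m + 3)) k) (MvPolynomial (Fin (m + 3)) k) :=
      pderiv (Fin.last (m + 2)) with hδ
    have hchain := fun f => derivation_algHom_fin_two ψ δ f
    have heq : ∀ i, D (θ (δ (ψ (X i)))) = (θ.comp ψ) (pderiv 0 (d (X i))) * θ (δ (ψ (X 0)))
        + (θ.comp ψ) (pderiv 1 (d (X i))) * θ (δ (ψ (X 1))) := by
      intro i
      rw [← hθ, hδ, ← towerDer_pderiv_last, ← hδ, ← hψ, hchain]
      simp
    obtain ⟨c, hx, hy⟩ := linearized_solution hd hc hD hS hι (heq 0) (heq 1)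
    have hX : ∀ i, δ (ψ (X i)) = algebraMap k _ c * ψ (d (X i)) := by
      intro i
      apply hθinj
      rw [map_mul, AlgHom.commutes]
      fin_cases i
      · exact hx
      · exact hy
    have hall : ∀ f, δ (ψ f) = algebraMap k _ c * ψ (d f) := by
      intro f
      rw [hchain, hX, hX, derivation_fin_two d f]
      simp only [map_add, map_mul]
      ring
    have hiter : ∀ (N : ℕ) f, δ^[N] (ψ f) = algebraMap k _ (c ^ N) * ψ (d^[N] f) := by
      intro N f
      induction N with
      | zero => simp
      | succ N ihN =>
        rw [Function.iterate_succ_apply', ihN, Derivation.leibniz, Derivation.map_algebraMap, hall,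
          Function.iterate_succ_apply', pow_succ, map_mul]
        simp only [smul_eq_mul]
        ring
    have hψinj : Function.Injective ψ := hd.injective ψ hψ
    have hc0 : c = 0 := by
      by_contra hne
      obtain ⟨N, hN⟩ := exists_iterate_pderiv_last_eq_zero (m + 2) (ψ (X 0))
      rw [← hδ, hiter, mul_eq_zero, or_iff_right (by simpa using pow_ne_zero N hne),
        map_eq_zero_iff _ hψinj] at hN
      obtain ⟨e, he⟩ := hc.of_iterate hN
      exact X_ne_C _ _ he
    have hzero : ∀ i, ∃ g, ψ (X i) = rename Fin.castSucc g := by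
      intro i
      apply pderiv_last_eq_zero (m + 2)
      rw [← hδ, hX, hc0, map_zero, zero_mul]
    choose g hg using hzero
    have hψ' : ψ = (rename Fin.castSucc).comp (aeval g) := by
      apply algHom_ext
      intro i
      simp [hg]
    have hren : Function.Injective (rename Fin.castSucc :
        MvPolynomial (Fin (m + 2)) k →ₐ[k] MvPolynomial (Fin (m + 3)) k) :=
      rename_injective _ (Fin.castSucc_injective _)
    obtain ⟨ψ₀, hψ₀⟩ := ih (θ.comp (rename Fin.castSucc)) (by
      intro f
      rw [AlgHom.comp_apply, towerDer_rename, hθ, AlgHom.comp_apply]) (aeval g) (by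
      intro f
      apply hren
      rw [towerDer_rename, ← AlgHom.comp_apply, ← AlgHom.comp_apply, ← hψ', hψ])
    refine ⟨ψ₀, fun f => ?_⟩
    rw [hψ', AlgHom.comp_apply, hψ₀, rename_rename]
    rfl

/-- Automorphisms commuting with the tower derivation fix the first two variables, provided the
isotropy group of the base derivation is trivial. -/
theorem isotropy_fixes_base (hd : DSimple d) (hc : ConstPrimitive d)
    (h0 : NoPrimitive d (Polynomial.aeval (X 1) (G 2))) (hG : ∀ j, 2 ≤ j → 0 < (G j).natDegree)
    (htriv : ∀ ρ : MvPolynomial (Fin 2) k ≃ₐ[k] MvPolynomial (Fin 2) k,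
      (∀ f, ρ (d f) = d (ρ f)) → ∀ f, ρ f = f)
    (m : ℕ) (ρ : MvPolynomial (Fin (m + 2)) k ≃ₐ[k] MvPolynomial (Fin (m + 2)) k)
    (hρ : ∀ f, ρ (towerDer d G m f) = towerDer d G m (ρ f)) (f : MvPolynomial (Fin 2) k) :
    ρ (rename (Fin.castLE (Nat.le_add_left 2 m)) f)
      = rename (Fin.castLE (Nat.le_add_left 2 m)) f := by
  have hinj : Function.Injective (rename (Fin.castLE (Nat.le_add_left 2 m)) :
      MvPolynomial (Fin 2) k →ₐ[k] MvPolynomial (Fin (m + 2)) k) :=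
    rename_injective _ (Fin.castLE_injective _)
  have key : ∀ ρ : MvPolynomial (Fin (m + 2)) k ≃ₐ[k] MvPolynomial (Fin (m + 2)) k,
      (∀ f, ρ (towerDer d G m f) = towerDer d G m (ρ f)) →
      ∃ ψ₀ : MvPolynomial (Fin 2) k →ₐ[k] MvPolynomial (Fin 2) k,
      ∀ f, ρ (rename (Fin.castLE (Nat.le_add_left 2 m)) f)
        = rename (Fin.castLE (Nat.le_add_left 2 m)) (ψ₀ f) := by
    intro ρ hρ
    refine exists_factor_castLE hd hc h0 hG (towerDer_simple hd h0 hG m) const_of_isUnit m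
      (AlgHom.id k _) (fun f => rfl)
      (ρ.toAlgHom.comp (rename (Fin.castLE (Nat.le_add_left 2 m)))) ?_
    intro f
    simp [towerDer_castLE d G, hρ]
  have hρ' : ∀ f, ρ.symm (towerDer d G m f) = towerDer d G m (ρ.symm f) := by
    intro f
    rw [AlgEquiv.symm_apply_eq, hρ, AlgEquiv.apply_symm_apply]
  obtain ⟨ψ₁, h1⟩ := key ρ hρ
  obtain ⟨ψ₂, h2⟩ := key ρ.symm hρ'
  have h12 : ∀ f, ψ₁ (ψ₂ f) = f := by
    intro f
    apply hinj
    rw [← h1, ← h2, AlgEquiv.apply_symm_apply]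
  have h21 : ∀ f, ψ₂ (ψ₁ f) = f := by
    intro f
    apply hinj
    rw [← h2, ← h1, AlgEquiv.symm_apply_apply]
  let ρ₀ : MvPolynomial (Fin 2) k ≃ₐ[k] MvPolynomial (Fin 2) k :=
    AlgEquiv.ofAlgHom ψ₁ ψ₂ (AlgHom.ext h12) (AlgHom.ext h21)
  have := htriv ρ₀ (by
    intro f
    apply hinj
    change rename _ (ψ₁ (d f)) = rename _ (d (ψ₁ f))
    rw [← h1, towerDer_castLE d G, towerDer_castLE d G, hρ, h1]) f
  rw [h1]
  exact congrArg _ this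

theorem Polynomial.eq_zero_of_comp_X_add_C_eq {p : Polynomial k} (hp : 0 < p.natDegree) {c : k}
    (h : p.comp (Polynomial.X + Polynomial.C c) = p) : c = 0 := by
  by_contra hc
  have hev : ∀ n : ℕ, p.eval (n * c) = p.eval 0 := by
    intro n
    induction n with
    | zero => simp
    | succ n ih =>
      have : p.eval (n * c + c) = p.eval (n * c) := by
        conv_rhs => rw [← h]
        simp
      rw [← ih, ← this]
      push_cast
      ring_nf
  have : p = Polynomial.C (p.eval 0) := by
    apply Polynomial.eq_of_infinite_eval_eq
    apply Set.infinite_of_injective_forall_mem (f := fun n : ℕ => (n : k) * c)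
    · intro a b hab
      have := mul_right_cancel₀ hc hab
      exact_mod_cast this
    · intro n
      simp [hev]
  rw [this, Polynomial.natDegree_C] at hp
  exact lt_irrefl _ hp

theorem isotropy_tower_forward (hd : DSimple d) (hc : ConstPrimitive d)
    (h0 : NoPrimitive d (Polynomial.aeval (X 1) (G 2))) (hG : ∀ j, 2 ≤ j → 0 < (G j).natDegree)
    (htriv : ∀ ρ : MvPolynomial (Fin 2) k ≃ₐ[k] MvPolynomial (Fin 2) k,
      (∀ f, ρ (d f) = d (ρ f)) → ∀ f, ρ f = f)
    (m : ℕ) (ρ : MvPolynomial (Fin (m + 2)) k ≃ₐ[k] MvPolynomial (Fin (m + 2)) k)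
    (hρ : ∀ f, ρ (towerDer d G m f) = towerDer d G m (ρ f)) (i : ℕ) (hi : i < m + 2) :
    ∃ c, ρ (X ⟨i, hi⟩) = X ⟨i, hi⟩ + C c ∧ (i + 1 < m + 2 → c = 0) := by
  have hbase : ∀ i (hi : i < m + 2), i < 2 → ρ (X ⟨i, hi⟩) = X ⟨i, hi⟩ := by
    intro i hi h2
    have := isotropy_fixes_base hd hc h0 hG htriv m ρ hρ (X ⟨i, h2⟩)
    rwa [rename_X] at this
  induction i with
  | zero => exact ⟨0, by rw [hbase 0 hi (by lia), map_zero, add_zero], fun _ => rfl⟩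
  | succ i ih =>
    by_cases h2 : i + 1 < 2
    · exact ⟨0, by simp [hbase _ hi h2], fun _ => rfl⟩
    obtain ⟨c', hc', hc'0⟩ := ih (by lia)
    rw [hc'0 hi, map_zero, add_zero] at hc'
    have hD : towerDer d G m (ρ (X ⟨i + 1, hi⟩) - X ⟨i + 1, hi⟩) = algebraMap k _ 0 := by
      rw [map_sub, ← hρ, towerDer_X d G _ _ (by lia)]
      have := Polynomial.aeval_algHom_apply ρ.toAlgHom (X ⟨i, by lia⟩) (G (i + 1))
      simp only [AlgEquiv.toAlgHom_apply, hc'] at this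
      simp only [Nat.add_sub_cancel]
      rw [← this]
      simp
    obtain ⟨-, c, hcc⟩ := (towerDer_noPrimitive h0 hG m).const hD
    refine ⟨c, by rw [← algebraMap_eq, ← hcc]; ring, fun hlt => ?_⟩
    have hX : ρ (X ⟨i + 1, hi⟩) = X ⟨i + 1, hi⟩ + C c := by rw [← algebraMap_eq, ← hcc]; ring
    have hD2 : towerDer d G m (ρ (X ⟨i + 1 + 1, hlt⟩) - X ⟨i + 1 + 1, hlt⟩)
        = Polynomial.aeval (X ⟨i + 1, hi⟩)
          ((G (i + 1 + 1)).comp (Polynomial.X + Polynomial.C c) - G (i + 1 + 1)) := by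
      rw [map_sub, ← hρ, towerDer_X d G _ _ (by lia)]
      have := Polynomial.aeval_algHom_apply ρ.toAlgHom (X ⟨i + 1, hi⟩) (G (i + 1 + 1))
      simp only [AlgEquiv.toAlgHom_apply, hX] at this
      simp only [Nat.add_sub_cancel]
      rw [← this, map_sub, Polynomial.aeval_comp]
      simp [algebraMap_eq]
    have hGi := hG (i + 1 + 1) (by lia)
    have := towerDer_eq_aeval h0 hG m ⟨i + 1, hi⟩ (by simp; lia) hlt
      (Polynomial.natDegree_comp_X_add_C_sub_lt hGi c) hD2
    exact Polynomial.eq_zero_of_comp_X_add_C_eq hGi (sub_eq_zero.mp this)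

theorem isotropy_tower (hd : DSimple d) (hc : ConstPrimitive d)
    (h0 : NoPrimitive d (Polynomial.aeval (X 1) (G 2))) (hG : ∀ j, 2 ≤ j → 0 < (G j).natDegree)
    (htriv : ∀ ρ : MvPolynomial (Fin 2) k ≃ₐ[k] MvPolynomial (Fin 2) k,
      (∀ f, ρ (d f) = d (ρ f)) → ∀ f, ρ f = f)
    (m : ℕ) (ρ : MvPolynomial (Fin (m + 3)) k ≃ₐ[k] MvPolynomial (Fin (m + 3)) k) :
    (∀ f, ρ (towerDer d G (m + 1) f) = towerDer d G (m + 1) (ρ f)) ↔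
      ∃ c : k, (∀ j : Fin (m + 3), (j : ℕ) + 1 < m + 3 → ρ (X j) = X j) ∧
        ρ (X (Fin.last (m + 2))) = X (Fin.last (m + 2)) + C c := by
  constructor
  · intro hρ
    have := isotropy_tower_forward hd hc h0 hG htriv (m + 1) ρ hρ
    obtain ⟨c, hlast, -⟩ := this (m + 2) (by lia)
    refine ⟨c, fun j hj => ?_, hlast⟩
    obtain ⟨c', h1, h2⟩ := this j j.2
    rw [h2 hj, map_zero, add_zero] at h1
    exact h1
  · rintro ⟨c, h1, h2⟩
    have hcast : ∀ i : Fin (m + 2), ρ (X (Fin.castSucc i)) = X (Fin.castSucc i) :=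
      fun i => h1 _ (by have := i.2; simp)
    have hfix : ∀ f : MvPolynomial (Fin (m + 2)) k,
        ρ (rename Fin.castSucc f) = rename Fin.castSucc f := by
      intro f
      have : ρ.toAlgHom.comp (rename Fin.castSucc) = rename Fin.castSucc := by
        apply algHom_ext
        intro i
        simp [hcast]
      exact congrArg (fun φ => φ f) this
    refine fun f => equivariant_of_X (φ := ρ.toAlgHom) ?_ f
    intro i
    simp only [AlgEquiv.toAlgHom_apply]
    induction i using Fin.lastCases with
    | last =>
      rw [towerDer_X_last, hfix, h2, map_add, towerDer_X_last, ← algebraMap_eq,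
        Derivation.map_algebraMap, add_zero]
    | cast i => rw [hcast, ← rename_X, ← towerDer_rename, hfix]

end Isotropy

section AlternatingWords

variable {Γ : Type*} [Group Γ] (s : Γ) (E : Subgroup Γ)

/-- Elements which are alternating words of length at most `n` in `E` and the involution `s`. -/
def IsWord (n : ℕ) (ρ : Γ) : Prop :=
  ∃ (l : List Γ) (ε : Γ), l.length ≤ n ∧ (∀ x ∈ l, x ∈ E) ∧ ε ∈ E ∧
    ρ = (l.map (· * s)).prod * ε

variable {s E}

theorem IsWord.of_mem {ρ : Γ} (h : ρ ∈ E) : IsWord s E 0 ρ := ⟨[], ρ, by simp, by simp, h, by simp⟩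

theorem IsWord.mul_right {n : ℕ} {ρ e : Γ} (h : IsWord s E n ρ) (he : e ∈ E) :
    IsWord s E n (ρ * e) := by
  obtain ⟨l, ε, h1, h2, h3, rfl⟩ := h
  exact ⟨l, ε * e, h1, h2, E.mul_mem h3 he, by group⟩

theorem IsWord.mul_swap {n : ℕ} {ρ : Γ} (h : IsWord s E n ρ) : IsWord s E (n + 1) (ρ * s) := by
  obtain ⟨l, ε, h1, h2, h3, rfl⟩ := h
  refine ⟨l ++ [ε], 1, by simpa using h1, ?_, E.one_mem, by simp [mul_assoc]⟩
  intro x hx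
  rcases List.mem_append.mp hx with hx | hx
  · exact h2 x hx
  · rw [List.mem_singleton] at hx; exact hx ▸ h3

theorem IsWord.mul_left {n : ℕ} {ρ e : Γ} (h : IsWord s E n ρ) (he : e ∈ E) :
    IsWord s E n (e * ρ) := by
  obtain ⟨l, ε, h1, h2, h3, rfl⟩ := h
  rcases l with _ | ⟨x, l⟩
  · exact ⟨[], e * ε, h1, by simp, E.mul_mem he h3, by simp⟩
  · refine ⟨(e * x) :: l, ε, h1, ?_, h3, by simp [mul_assoc]⟩
    simp only [List.forall_mem_cons] at h2 ⊢
    exact ⟨E.mul_mem he h2.1, h2.2⟩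

theorem IsWord.mul_swap_left {n : ℕ} {ρ e : Γ} (h : IsWord s E n ρ) (he : e ∈ E) :
    IsWord s E (n + 1) (e * s * ρ) := by
  obtain ⟨l, ε, h1, h2, h3, rfl⟩ := h
  refine ⟨e :: l, ε, by simpa using h1, ?_, h3, by simp [mul_assoc]⟩
  simp only [List.forall_mem_cons]
  exact ⟨he, h2⟩

theorem isConj_prod_rotate (l₁ l₂ : List Γ) : IsConj (l₁ ++ l₂).prod (l₂ ++ l₁).prod := by
  rw [isConj_iff]
  exact ⟨l₁.prod⁻¹, by simp⟩

theorem isWord_prod (l : List Γ) (h : ∀ x ∈ l, x ∈ E) :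
    IsWord s E l.length (l.map (· * s)).prod :=
  ⟨l, 1, le_rfl, h, E.one_mem, by simp⟩

/-- Cyclic reduction of alternating words. -/
theorem IsWord.reduce {A : Set Γ} (hA : A ⊆ E)
    (hAs : ∀ a ∈ A, s * a * s ∈ E ∨ ∃ b ∈ A, ∃ b' ∈ A, s * a * s = b * s * b')
    {n : ℕ} {ρ : Γ} (h : IsWord s E n ρ) :
    (∃ ε ∈ E, IsConj ρ ε) ∨ (∃ ε ∈ A, IsConj ρ (ε * s)) ∨
      ∃ l : List Γ, l ≠ [] ∧ (∀ x ∈ l, x ∈ E ∧ x ∉ A) ∧ IsConj ρ (l.map (· * s)).prod := by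
  induction n using Nat.strong_induction_on generalizing ρ with
  | _ n ih =>
  have ih' : ∀ ρ' m, IsConj ρ ρ' → IsWord s E m ρ' → m < n →
      (∃ ε ∈ E, IsConj ρ ε) ∨ (∃ ε ∈ A, IsConj ρ (ε * s)) ∨
      ∃ l : List Γ, l ≠ [] ∧ (∀ x ∈ l, x ∈ E ∧ x ∉ A) ∧ IsConj ρ (l.map (· * s)).prod := by
    intro ρ' m hc hw hm
    rcases ih m hm hw with ⟨ε, h1, h2⟩ | ⟨ε, h1, h2⟩ | ⟨l, h1, h2, h3⟩
    · exact Or.inl ⟨ε, h1, hc.trans h2⟩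
    · exact Or.inr (Or.inl ⟨ε, h1, hc.trans h2⟩)
    · exact Or.inr (Or.inr ⟨l, h1, h2, hc.trans h3⟩)
  obtain ⟨l, ε, hl, hlE, hε, rfl⟩ := h
  rcases l with _ | ⟨x, l⟩
  · left
    exact ⟨ε, hε, by simpa using IsConj.refl ε⟩
  simp only [List.forall_mem_cons] at hlE
  have hconj : IsConj (((x :: l).map (· * s)).prod * ε) (((ε * x) :: l).map (· * s)).prod := by
    rw [isConj_iff]
    exact ⟨ε, by simp [mul_assoc]⟩
  have hallE : ∀ y ∈ (ε * x) :: l, y ∈ E := by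
    simp only [List.forall_mem_cons]
    exact ⟨E.mul_mem hε hlE.1, hlE.2⟩
  have hlen : ((ε * x) :: l).length ≤ n := by simpa using hl
  set L := (ε * x) :: l with hL
  by_cases hne : ∀ y ∈ L, y ∉ A
  · exact Or.inr (Or.inr ⟨L, by simp [hL], fun y hy => ⟨hallE y hy, hne y hy⟩, hconj⟩)
  push Not at hne
  obtain ⟨a, haL, haA⟩ := hne
  obtain ⟨l₁, l₂, hsplit⟩ := List.append_of_mem haL
  have hrot : IsConj (L.map (· * s)).prod (((a :: l₂) ++ l₁).map (· * s)).prod := by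
    rw [hsplit, List.map_append, List.map_append]
    exact isConj_prod_rotate _ _
  have hmem : ∀ y ∈ l₂ ++ l₁, y ∈ E := by
    intro y hy
    apply hallE
    rw [hsplit]
    simp only [List.mem_append, List.mem_cons] at hy ⊢
    tauto
  have hlen2 : (l₂ ++ l₁).length + 1 ≤ n := by
    rw [hsplit] at hlen
    simp at hlen ⊢
    lia
  rcases List.eq_nil_or_concat (l₂ ++ l₁) with hnil | ⟨l₃, e, hl₃⟩
  · right; left
    refine ⟨a, haA, ?_⟩
    have := hconj.trans hrot
    rw [List.cons_append, hnil] at this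
    simpa using this
  · rw [List.concat_eq_append] at hl₃
    rw [hl₃] at hmem hlen2
    have heE : e ∈ E := hmem e (by simp)
    have hl₃E : ∀ y ∈ l₃, y ∈ E := fun y hy => hmem y (by simp [hy])
    have h3 : IsConj (((x :: l).map (· * s)).prod * ε)
        (e * (s * a * s) * (l₃.map (· * s)).prod) := by
      refine (hconj.trans hrot).trans ?_
      rw [List.cons_append, hl₃, isConj_iff]
      exact ⟨e * s, by simp [mul_assoc]⟩
    have hw := isWord_prod (s := s) l₃ hl₃E
    simp only [List.length_append, List.length_singleton] at hlen2
    rcases hAs a haA with h | ⟨b, hb, b', hb', h⟩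
    · exact ih' _ l₃.length h3 (hw.mul_left (E.mul_mem heE h)) (by lia)
    · refine ih' _ (l₃.length + 1) h3 ?_ (by lia)
      rw [h, show e * (b * s * b') * (l₃.map (· * s)).prod
        = (e * b) * s * (b' * (l₃.map (· * s)).prod) by group]
      exact (hw.mul_left (hA hb')).mul_swap_left (E.mul_mem heE (hA hb))

end AlternatingWords

section LocallyNilpotent

variable {k A : Type*} [CommSemiring k] [CommRing A] [Algebra k A] {D : Derivation k A A}

theorem Derivation.iterate_mul_of_iterate_eq_zero (a b : ℕ) {f g : A} (hf : D^[a + 1] f = 0)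
    (hg : D^[b + 1] g = 0) : D^[a + b] (f * g) = (a + b).choose a • (D^[a] f * D^[b] g) := by
  induction a generalizing b f g with
  | zero =>
    induction b generalizing g with
    | zero => simp
    | succ b ih =>
      have h1 : D (f * g) = f * D g := by
        rw [Derivation.leibniz, show D f = 0 from hf]; simp
      have := ih (g := D g) hg
      rw [← add_assoc, Function.iterate_succ_apply, h1, this]
      simp
  | succ a iha =>
    induction b generalizing f g with
    | zero =>
      have h1 : D (f * g) = D f * g := by
        rw [Derivation.leibniz, show D g = 0 from hg]; simp [mul_comm]
      have := iha 0 (f := D f) (g := g) hf hg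
      rw [add_right_comm, Function.iterate_succ_apply, h1]
      simpa [Function.iterate_succ_apply] using this
    | succ b ihb =>
      have h1 : D (f * g) = f * D g + D f * g := by
        rw [Derivation.leibniz]; simp [mul_comm]
      have e1 := ihb (f := f) (g := D g) hf hg
      have e2 := iha (b + 1) (f := D f) (g := g) hf hg
      rw [← add_assoc, Function.iterate_succ_apply, h1, iterate_map_add, e1,
        show a + 1 + b = a + (b + 1) by ring, e2, ← Function.iterate_succ_apply,
        ← Function.iterate_succ_apply, ← add_smul]
      congr 1
      rw [show a + (b + 1) + 1 = (a + (b + 1)) + 1 by ring, Nat.choose_succ_succ]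
      ring

/-- The nilpotency degree of `f` under `D` is `a`. -/
def Derivation.HasNilDegree (D : Derivation k A A) (f : A) (a : ℕ) : Prop :=
  D^[a] f ≠ 0 ∧ D^[a + 1] f = 0

theorem Derivation.iterate_eq_zero_of_le {f : A} {a b : ℕ} (h : D^[a] f = 0) (hab : a ≤ b) :
    D^[b] f = 0 := by
  obtain ⟨c, rfl⟩ := Nat.exists_eq_add_of_le hab
  rw [add_comm, Function.iterate_add_apply, h]
  exact iterate_map_zero D c

theorem Derivation.HasNilDegree.unique {f : A} {a b : ℕ} (ha : D.HasNilDegree f a)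
    (hb : D.HasNilDegree f b) : a = b := by
  rcases lt_trichotomy a b with h | h | h
  · exact absurd (iterate_eq_zero_of_le ha.2 h) hb.1
  · exact h
  · exact absurd (iterate_eq_zero_of_le hb.2 h) ha.1

theorem Derivation.exists_hasNilDegree {f : A} (hf : f ≠ 0) (hD : ∃ n, D^[n] f = 0) :
    ∃ a, D.HasNilDegree f a := by
  classical
  have h := Nat.find_spec hD
  have h0 : Nat.find hD ≠ 0 := by
    intro h0
    rw [h0] at h
    exact hf h
  refine ⟨Nat.find hD - 1, Nat.find_min hD (by lia), ?_⟩
  rwa [Nat.sub_add_cancel (by lia)]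

theorem Derivation.HasNilDegree.mul [IsDomain A] [CharZero A] {f g : A} {a b : ℕ}
    (hf : D.HasNilDegree f a) (hg : D.HasNilDegree g b) : D.HasNilDegree (f * g) (a + b) := by
  constructor
  · rw [iterate_mul_of_iterate_eq_zero a b hf.2 hg.2, nsmul_eq_mul]
    refine mul_ne_zero ?_ (mul_ne_zero hf.1 hg.1)
    exact_mod_cast (Nat.choose_pos (Nat.le_add_right a b)).ne'
  · rw [show a + b + 1 = a + 1 + b by ring,
      iterate_mul_of_iterate_eq_zero (a + 1) b (iterate_eq_zero_of_le hf.2 (by lia)) hg.2, hf.2]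
    simp

theorem Derivation.HasNilDegree.apply {f : A} {a : ℕ} (hf : D.HasNilDegree f a) (h : D f ≠ 0) :
    ∃ b, a = b + 1 ∧ D.HasNilDegree (D f) b := by
  rcases a with _ | b
  · exact absurd hf.2 h
  · exact ⟨b, rfl, hf⟩

/-- The kernel of a locally nilpotent derivation is factorially closed. -/
theorem Derivation.eq_zero_of_mul_eq_zero [IsDomain A] [CharZero A] (hD : ∀ f, ∃ n, D^[n] f = 0)
    {f g : A} (hfg : f * g ≠ 0) (h : D (f * g) = 0) : D f = 0 := by
  obtain ⟨a, ha⟩ := exists_hasNilDegree (left_ne_zero_of_mul hfg) (hD f)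
  obtain ⟨b, hb⟩ := exists_hasNilDegree (right_ne_zero_of_mul hfg) (hD g)
  have h0 : D.HasNilDegree (f * g) 0 := ⟨hfg, h⟩
  have := (ha.mul hb).unique h0
  have ha0 : a = 0 := by lia
  subst ha0
  exact ha.2

theorem Derivation.eq_zero_of_dvd_of_dvd [IsDomain A] [CharZero A]
    (hD : ∀ f, ∃ n, D^[n] f = 0) {x y : A} (hx : D x ≠ 0) (hy : D y ≠ 0) (hyx : y ∣ D x)
    (hxy : x ∣ D y) : False := by
  obtain ⟨p, hp⟩ := hyx
  obtain ⟨q, hq⟩ := hxy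
  have hy0 : y ≠ 0 := by rintro rfl; simp at hy
  have hx0 : x ≠ 0 := by rintro rfl; simp at hx
  obtain ⟨a, ha⟩ := exists_hasNilDegree hx0 (hD x)
  obtain ⟨b, hb⟩ := exists_hasNilDegree hy0 (hD y)
  obtain ⟨a', rfl, ha'⟩ := ha.apply hx
  obtain ⟨b', rfl, hb'⟩ := hb.apply hy
  have hp0 : p ≠ 0 := by rintro rfl; simp [hp] at hx
  have hq0 : q ≠ 0 := by rintro rfl; simp [hq] at hy
  obtain ⟨c, hc⟩ := exists_hasNilDegree hp0 (hD p)
  obtain ⟨e, he⟩ := exists_hasNilDegree hq0 (hD q)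
  rw [hp] at ha'
  rw [hq] at hb'
  have h1 := ha'.unique (hb.mul hc)
  have h2 := hb'.unique (ha.mul he)
  lia

end LocallyNilpotent

section WeightedDerivation

variable {k σ : Type*} [Field k] (w : σ → ℤ)

/-- Every monomial of `f` has weight at most `n`. -/
def WeightLE (n : ℤ) (f : MvPolynomial σ k) : Prop :=
  ∀ m, coeff m f ≠ 0 → Finsupp.weight w m ≤ n

variable {w}

theorem WeightLE.mono {n n' : ℤ} {f : MvPolynomial σ k} (h : WeightLE w n f) (hn : n ≤ n') :
    WeightLE w n' f := fun m hm => (h m hm).trans hn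

theorem WeightLE.add {n : ℤ} {f g : MvPolynomial σ k} (hf : WeightLE w n f)
    (hg : WeightLE w n g) : WeightLE w n (f + g) := by
  intro m hm
  by_cases h : coeff m f = 0
  · exact hg m (by rwa [coeff_add, h, zero_add] at hm)
  · exact hf m h

theorem WeightLE.mul {p q : ℤ} {f g : MvPolynomial σ k} (hf : WeightLE w p f)
    (hg : WeightLE w q g) : WeightLE w (p + q) (f * g) := by
  classical
  intro m hm
  rw [coeff_mul] at hm
  obtain ⟨⟨a, b⟩, hab, h⟩ := Finset.exists_ne_zero_of_sum_ne_zero hm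
  rw [Finset.HasAntidiagonal.mem_antidiagonal] at hab
  simp only at hab
  rw [← hab, map_add]
  exact add_le_add (hf a (left_ne_zero_of_mul h)) (hg b (right_ne_zero_of_mul h))

theorem weightLE_monomial (m : σ →₀ ℕ) (c : k) : WeightLE w (Finsupp.weight w m) (monomial m c) := by
  classical
  intro m' hm'
  rw [coeff_monomial] at hm'
  have : m = m' := by by_contra h; simp [h] at hm'
  rw [this]

theorem WeightLE.component_of_lt {n n' : ℤ} {f : MvPolynomial σ k} (h : WeightLE w n f)
    (hn : n < n') : weightedHomogeneousComponent w n' f = 0 := by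
  classical
  ext m
  rw [coeff_weightedHomogeneousComponent, coeff_zero]
  split_ifs with hm
  · by_contra h0
    exact absurd (h m h0) (by lia)
  · rfl

theorem component_monomial (m : σ →₀ ℕ) (c : k) :
    weightedHomogeneousComponent w (Finsupp.weight w m) (monomial m c) = monomial m c := by
  classical
  ext m'
  rw [coeff_weightedHomogeneousComponent, coeff_monomial]
  by_cases h : m = m'
  · subst h; simp
  · simp [h]

theorem WeightLE.component_mul {p q : ℤ} {f g : MvPolynomial σ k} (hf : WeightLE w p f)
    (hg : WeightLE w q g) : weightedHomogeneousComponent w (p + q) (f * g) =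
      weightedHomogeneousComponent w p f * weightedHomogeneousComponent w q g := by
  classical
  ext m
  rw [coeff_weightedHomogeneousComponent]
  split_ifs with hm
  · rw [coeff_mul, coeff_mul]
    refine Finset.sum_congr rfl ?_
    rintro ⟨a, b⟩ hab
    rw [Finset.HasAntidiagonal.mem_antidiagonal] at hab
    simp only at hab
    rw [← hab, map_add] at hm
    simp only [coeff_weightedHomogeneousComponent]
    by_cases h1 : coeff a f = 0
    · simp [h1]
    by_cases h2 : coeff b g = 0
    · simp [h2]
    have ha := hf a h1
    have hb := hg b h2
    rw [if_pos (by lia), if_pos (by lia)]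
  · by_contra h
    exact hm (((weightedHomogeneousComponent_isWeightedHomogeneous (w := w) p f).mul
      (weightedHomogeneousComponent_isWeightedHomogeneous (w := w) q g)) (Ne.symm h))

variable (w) in
/-- The component of a derivation raising weights by `e`. -/
noncomputable def topDerivation (D : Derivation k (MvPolynomial σ k) (MvPolynomial σ k)) (e : ℤ) :
    Derivation k (MvPolynomial σ k) (MvPolynomial σ k) :=
  mkDerivation k fun i => weightedHomogeneousComponent w (e + w i) (D (X i))

variable {D : Derivation k (MvPolynomial σ k) (MvPolynomial σ k)} {e : ℤ}

theorem topDerivation_component (hD : ∀ i, WeightLE w (e + w i) (D (X i))) {n : ℤ}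
    {f : MvPolynomial σ k} (hf : WeightLE w n f) :
    WeightLE w (n + e) (D f) ∧ weightedHomogeneousComponent w (n + e) (D f) =
      topDerivation w D e (weightedHomogeneousComponent w n f) := by
  set H : MvPolynomial σ k → ℤ → Prop := fun f n => WeightLE w n f ∧ WeightLE w (n + e) (D f) ∧
    weightedHomogeneousComponent w (n + e) (D f) =
      topDerivation w D e (weightedHomogeneousComponent w n f) with hH
  have hmul : ∀ f g p q, H f p → H g q → H (f * g) (p + q) := by
    rintro f g p q ⟨f1, f2, f3⟩ ⟨g1, g2, g3⟩
    have e1 := f1.mul g2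
    have e2 := g1.mul f2
    rw [show p + (q + e) = p + q + e by ring] at e1
    rw [show q + (p + e) = p + q + e by ring] at e2
    refine ⟨f1.mul g1, ?_, ?_⟩
    · rw [Derivation.leibniz]
      exact e1.add e2
    · rw [Derivation.leibniz, f1.component_mul g1, Derivation.leibniz, map_add, ← f3, ← g3,
        smul_eq_mul, smul_eq_mul, smul_eq_mul, smul_eq_mul,
        show p + q + e = p + (q + e) by ring, f1.component_mul g2,
        show p + (q + e) = q + (p + e) by ring, g1.component_mul f2]
  have hC : ∀ c : k, H (C c) 0 := by
    intro c
    have hD : D (C c) = 0 := by rw [← algebraMap_eq]; exact D.map_algebraMap c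
    have hz := component_monomial (w := w) (0 : σ →₀ ℕ) c
    have hz' := weightLE_monomial (w := w) (0 : σ →₀ ℕ) c
    rw [map_zero] at hz hz'
    refine ⟨hz', ?_, ?_⟩
    · intro m hm; rw [hD] at hm; simp at hm
    · rw [hD, show (C c : MvPolynomial σ k) = monomial 0 c from rfl, hz,
        show (monomial 0 c : MvPolynomial σ k) = algebraMap k _ c from rfl,
        Derivation.map_algebraMap, map_zero]
  have hX : ∀ i, H (X i) (w i) := by
    intro i
    have hz := component_monomial (w := w) (Finsupp.single i 1) (1 : k)
    have hz' := weightLE_monomial (w := w) (Finsupp.single i 1) (1 : k)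
    rw [Finsupp.weight_single, one_smul] at hz hz'
    refine ⟨hz', ?_, ?_⟩
    · rw [add_comm]; exact hD i
    · change _ = topDerivation w D e (weightedHomogeneousComponent w (w i) (monomial _ 1))
      rw [hz]
      change _ = topDerivation w D e (X i)
      rw [topDerivation, mkDerivation_X, add_comm]
  have hpow : ∀ i (n : ℕ), H (X i ^ n) (n * w i) := by
    intro i n
    induction n with
    | zero => simpa using hC 1
    | succ n ih =>
      rw [pow_succ, show ((n + 1 : ℕ) : ℤ) * w i = n * w i + w i by push_cast; ring]
      exact hmul _ _ _ _ ih (hX i)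
  have hmon : ∀ m : σ →₀ ℕ, H (monomial m 1) (Finsupp.weight w m) := by
    intro m
    induction m using Finsupp.induction_linear with
    | zero => simpa using hC 1
    | add m m' h h' =>
      rw [show (monomial (m + m') 1 : MvPolynomial σ k) = monomial m 1 * monomial m' 1 by
        rw [monomial_mul, one_mul], map_add]
      exact hmul _ _ _ _ h h'
    | single i n =>
      have := hpow i n
      rwa [X_pow_eq_monomial, ← nsmul_eq_mul, ← Finsupp.weight_single] at this
  have hmon' : ∀ (m : σ →₀ ℕ) (c : k), H (monomial m c) (Finsupp.weight w m) := by
    intro m c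
    have := hmul _ _ _ _ (hC c) (hmon m)
    rwa [C_mul_monomial, mul_one, zero_add] at this
  rw [f.as_sum]
  have hsum : ∀ s ⊆ f.support, H (∑ m ∈ s, monomial m (coeff m f)) n := by
    intro s
    classical
    induction s using Finset.induction_on with
    | empty =>
      intro _
      refine ⟨?_, ?_, by simp⟩ <;> intro m hm <;> simp at hm
    | insert m s hms ih =>
      intro hs
      rw [Finset.sum_insert hms]
      obtain ⟨a1, a2, a3⟩ := ih ((Finset.subset_insert _ _).trans hs)
      obtain ⟨b1, b2, b3⟩ := hmon' m (coeff m f)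
      have hm := hf m (mem_support_iff.mp (hs (Finset.mem_insert_self _ _)))
      refine ⟨(b1.mono hm).add a1, ?_, ?_⟩
      · rw [map_add]; exact (b2.mono (by lia)).add a2
      · rw [map_add, map_add, map_add, map_add, a3, add_left_inj]
        rcases hm.lt_or_eq with h | h
        · rw [b1.component_of_lt h, b2.component_of_lt (by lia), map_zero]
        · rw [← h, b3]
  exact (hsum _ subset_rfl).2

theorem topDerivation_iterate_component (hD : ∀ i, WeightLE w (e + w i) (D (X i))) {n : ℤ}
    {f : MvPolynomial σ k} (hf : WeightLE w n f) (j : ℕ) :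
    WeightLE w (n + j * e) (D^[j] f) ∧ weightedHomogeneousComponent w (n + j * e) (D^[j] f) =
      (topDerivation w D e)^[j] (weightedHomogeneousComponent w n f) := by
  induction j with
  | zero => simpa using hf
  | succ j ih =>
    rw [Function.iterate_succ_apply', Function.iterate_succ_apply', ← ih.2,
      show n + ((j + 1 : ℕ) : ℤ) * e = n + j * e + e by push_cast; ring]
    exact topDerivation_component hD ih.1

theorem topDerivation_nilpotent (hD : ∀ i, WeightLE w (e + w i) (D (X i)))
    (hnil : ∀ f, ∃ n, D^[n] f = 0) (f : MvPolynomial σ k) :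
    ∃ n, (topDerivation w D e)^[n] f = 0 := by
  induction f using MvPolynomial.induction_on' with
  | monomial m c =>
    obtain ⟨n, hn⟩ := hnil (monomial m c)
    refine ⟨n, ?_⟩
    have := (topDerivation_iterate_component hD (weightLE_monomial m c) n).2
    rw [hn, map_zero, component_monomial] at this
    exact this.symm
  | add p q hp hq =>
    obtain ⟨a, ha⟩ := hp
    obtain ⟨b, hb⟩ := hq
    refine ⟨a + b, ?_⟩
    rw [iterate_map_add, Derivation.iterate_eq_zero_of_le ha (by lia),
      Derivation.iterate_eq_zero_of_le hb (by lia), add_zero]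

theorem exists_topDerivation_ne_zero [Finite σ] (w : σ → ℤ) (hD : D ≠ 0) :
    ∃ e, (∀ i, WeightLE w (e + w i) (D (X i))) ∧ topDerivation w D e ≠ 0 := by
  classical
  have := Fintype.ofFinite σ
  set T : Finset (Σ _ : σ, σ →₀ ℕ) := Finset.univ.sigma fun i => (D (X i)).support with hT
  have hne : T.Nonempty := by
    by_contra h
    apply hD
    apply derivation_ext
    intro i
    ext m
    by_contra h0
    apply h
    exact ⟨⟨i, m⟩, by simpa [hT] using h0⟩
  obtain ⟨⟨i, m⟩, him, hmax⟩ :=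
    T.exists_max_image (fun x => Finsupp.weight w x.2 - w x.1) hne
  refine ⟨Finsupp.weight w m - w i, ?_, ?_⟩
  · intro j m' hm'
    have := hmax ⟨j, m'⟩ (by simpa [hT] using hm')
    simp only at this
    lia
  · intro h
    have h1 := congrArg (fun d => coeff m (d (X i))) h
    simp only [topDerivation, mkDerivation_X, sub_add_cancel, Derivation.coe_zero, Pi.zero_apply,
      coeff_zero, coeff_weightedHomogeneousComponent, if_true] at h1
    simp [hT, h1] at him

end WeightedDerivation

section ElementaryReduction

variable {k : Type*} [Field k]

theorem weight_fin_two (p q : ℤ) (m : Fin 2 →₀ ℕ) :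
    Finsupp.weight ![p, q] m = m 0 * p + m 1 * q := by
  rw [Finsupp.weight_apply, Finsupp.sum_fintype _ _ (by simp)]
  simp

/-- A homogeneous relation over `k` between polynomials forces proportionality. -/
theorem exists_eq_C_mul_of_homogeneous_relation {ι : Type*} (T : Finset ι) (q : ι → k) (c : ι → ℕ)
    (L : ℕ) (hL : ∀ i ∈ T, c i ≤ L) (hf : ∑ i ∈ T, Polynomial.monomial (c i) (q i) ≠ 0)
    {a b : Polynomial k} (hb : b ≠ 0)
    (h : ∑ i ∈ T, Polynomial.C (q i) * a ^ c i * b ^ (L - c i) = 0) :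
    ∃ μ : k, a = Polynomial.C μ * b ∧ ∑ i ∈ T, q i * μ ^ c i = 0 := by
  let K := FractionRing (Polynomial k)
  set f := ∑ i ∈ T, Polynomial.monomial (c i) (q i) with hfdef
  set a' := algebraMap (Polynomial k) K a with ha'
  set b' := algebraMap (Polynomial k) K b with hb'
  have hb0 : b' ≠ 0 := by
    rw [hb', Ne, map_eq_zero_iff _ (IsFractionRing.injective (Polynomial k) K)]
    exact hb
  obtain ⟨θ, hθb⟩ : ∃ θ, θ * b' = a' := ⟨a' / b', div_mul_cancel₀ _ hb0⟩
  have hθ : Polynomial.aeval θ f = 0 := by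
    have h1 : b' ^ L * Polynomial.aeval θ f = 0 := by
      have h2 := congrArg (algebraMap (Polynomial k) K) h
      rw [map_zero, map_sum] at h2
      rw [← h2, hfdef, map_sum, Finset.mul_sum]
      refine Finset.sum_congr rfl fun i hi => ?_
      rw [Polynomial.aeval_monomial, map_mul, map_mul, map_pow, map_pow, ← ha', ← hb',
        ← Polynomial.algebraMap_eq, ← IsScalarTower.algebraMap_apply, ← hθb, mul_pow]
      have : b' ^ L = b' ^ c i * b' ^ (L - c i) := by rw [← pow_add, Nat.add_sub_cancel' (hL i hi)]
      rw [this]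
      ring
    exact (mul_eq_zero.mp h1).resolve_left (pow_ne_zero _ hb0)
  have hθ_int : IsIntegral (Polynomial k) θ :=
    (IsAlgebraic.isIntegral (⟨f, hf, hθ⟩ : IsAlgebraic k θ)).tower_top
  obtain ⟨y, hy⟩ := IsIntegrallyClosed.isIntegral_iff.mp hθ_int
  rw [← hy, Polynomial.aeval_algebraMap_apply,
    map_eq_zero_iff _ (IsFractionRing.injective (Polynomial k) K), ← Polynomial.comp_eq_aeval,
    Polynomial.comp_eq_zero_iff] at hθ
  obtain ⟨h1, h2⟩ := hθ.resolve_left hf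
  refine ⟨y.coeff 0, ?_, ?_⟩
  · apply IsFractionRing.injective (Polynomial k) K
    rw [map_mul, ← h2, hy, ← ha', ← hb', hθb]
  · rw [hfdef, Polynomial.eval_finsetSum] at h1
    simpa using h1

/-- A factor of a weighted homogeneous polynomial vanishing at a pair of nonzero polynomials. -/
theorem exists_dvd_of_isWeightedHomogeneous {α β : ℕ} (hα : 0 < α) (hβ : 0 < β) {W : ℤ}
    {Q : MvPolynomial (Fin 2) k} (hQ : Q ≠ 0) (hW : IsWeightedHomogeneous ![(α : ℤ), (β : ℤ)] Q W)
    {a b : Polynomial k} (ha : a ≠ 0) (hb : b ≠ 0) (h : aeval ![a, b] Q = 0) :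
    ∃ (s t : ℕ) (μ : k), 0 < s ∧ 0 < t ∧ s * α = t * β ∧ μ ≠ 0 ∧
      X 0 ^ s - C μ * X 1 ^ t ∣ Q ∧ a ^ s = Polynomial.C μ * b ^ t := by
  obtain ⟨g, s, t, hg, hcop, hβs, hαt⟩ : ∃ g s t : ℕ, 0 < g ∧ Nat.Coprime s t ∧ β = s * g ∧
      α = t * g := by
    obtain ⟨g, s, t, h1, h2, h3, h4⟩ := Nat.exists_coprime' (m := β) (n := α)
      (Nat.gcd_pos_of_pos_left _ hβ)
    exact ⟨g, s, t, h1, h2, h3, h4⟩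
  have hs : 0 < s := Nat.pos_of_ne_zero (by rintro rfl; simp at hβs; lia)
  have ht : 0 < t := Nat.pos_of_ne_zero (by rintro rfl; simp at hαt; lia)
  have hne : Q.support.Nonempty := by rwa [Finset.nonempty_iff_ne_empty, Ne, support_eq_empty]
  obtain ⟨m₀, hm₀, hmin⟩ := Q.support.exists_min_image (fun m => m 0) hne
  have hwt : ∀ m ∈ Q.support, t * m 0 + s * m 1 = t * m₀ 0 + s * m₀ 1 := by
    intro m hm
    have e1 := hW (mem_support_iff.mp hm)
    have e2 := hW (mem_support_iff.mp hm₀)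
    rw [← e2] at e1
    rw [weight_fin_two, weight_fin_two] at e1
    norm_cast at e1
    rw [hβs, hαt] at e1
    have : g * (t * m 0 + s * m 1) = g * (t * m₀ 0 + s * m₀ 1) := by linarith
    exact Nat.eq_of_mul_eq_mul_left hg this
  have hc : ∀ m ∈ Q.support, m 0 = m₀ 0 + s * ((m 0 - m₀ 0) / s) ∧
      m₀ 1 = m 1 + t * ((m 0 - m₀ 0) / s) := by
    intro m hm
    have h1 := hwt m hm
    have h2 := hmin m hm
    obtain ⟨z, hz⟩ := Nat.exists_eq_add_of_le h2
    have h3 : t * z + s * m 1 = s * m₀ 1 := by rw [hz] at h1; linarith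
    have h4 : s ∣ z := by
      refine hcop.dvd_of_dvd_mul_left (k := s) (m := t) (n := z) ?_
      exact (Nat.dvd_add_left (dvd_mul_right s (m 1))).mp (h3 ▸ dvd_mul_right _ _)
    obtain ⟨y, rfl⟩ := h4
    have h5 : (m 0 - m₀ 0) / s = y := by
      rw [hz, Nat.add_sub_cancel_left, Nat.mul_div_cancel_left _ hs]
    rw [h5]
    refine ⟨hz, ?_⟩
    have : s * (t * y + m 1) = s * m₀ 1 := by linarith
    have := Nat.eq_of_mul_eq_mul_left hs this
    lia
  set c : (Fin 2 →₀ ℕ) → ℕ := fun m => (m 0 - m₀ 0) / s with hcdef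
  set L := m₀ 1 / t with hLdef
  set r := m₀ 1 % t with hrdef
  have hr : m₀ 1 = r + t * L := (Nat.mod_add_div _ _).symm
  have hcL : ∀ m ∈ Q.support, c m ≤ L := by
    intro m hm
    rw [hLdef, Nat.le_div_iff_mul_le ht, mul_comm]
    rw [(hc m hm).2]
    exact Nat.le_add_left _ _
  have hm1 : ∀ m ∈ Q.support, m 1 = r + t * (L - c m) := by
    intro m hm
    have e1 := (hc m hm).2
    obtain ⟨z, hz⟩ := Nat.exists_eq_add_of_le (hcL m hm)
    have e1' : m₀ 1 = m 1 + t * c m := e1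
    rw [hr, hz] at e1'
    rw [hz, Nat.add_sub_cancel_left]
    linarith
  have hsum : ∀ {S : Type _} [CommRing S] [Algebra k S] (x y : S),
      aeval ![x, y] Q = x ^ m₀ 0 * y ^ r *
        ∑ m ∈ Q.support, algebraMap k S (coeff m Q) * (x ^ s) ^ c m * (y ^ t) ^ (L - c m) := by
    intro S _ _ x y
    conv_lhs => rw [Q.as_sum]
    rw [map_sum, Finset.mul_sum]
    refine Finset.sum_congr rfl fun m hm => ?_
    rw [aeval_monomial, Finsupp.prod_fintype _ _ (by simp), Fin.prod_univ_two]
    simp only [Matrix.cons_val_zero, Matrix.cons_val_one]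
    rw [hm1 m hm, (hc m hm).1]
    change _ * (x ^ (m₀ 0 + s * c m) * _) = _
    ring
  have hrel := hsum a b
  rw [h, eq_comm] at hrel
  have hrel := (mul_eq_zero.mp hrel).resolve_left
    (mul_ne_zero (pow_ne_zero _ ha) (pow_ne_zero _ hb))
  have hf0 : ∑ m ∈ Q.support, Polynomial.monomial (c m) (coeff m Q) ≠ 0 := by
    intro h0
    have h0' := congrArg (fun p => Polynomial.coeff p 0) h0
    simp only [Polynomial.finsetSum_coeff, Polynomial.coeff_monomial, Polynomial.coeff_zero] at h0'
    rw [Finset.sum_eq_single_of_mem m₀ hm₀] at h0'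
    · simp [hcdef] at h0'
      exact mem_support_iff.mp hm₀ h0'
    · intro m hm hmne
      rw [if_neg]
      intro h00
      apply hmne
      have e1 := hc m hm
      have e2 : (m 0 - m₀ 0) / s = 0 := h00
      rw [e2] at e1
      ext i
      fin_cases i
      · simpa using e1.1
      · simpa using e1.2.symm
  obtain ⟨μ, h1, h2⟩ := exists_eq_C_mul_of_homogeneous_relation Q.support (fun m => coeff m Q) c L
    hcL hf0 (pow_ne_zero t hb) hrel
  · refine ⟨s, t, μ, hs, ht, by rw [hαt, hβs]; ring, ?_, ?_, h1⟩
    · rintro rfl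
      rw [Polynomial.C_0, zero_mul] at h1
      exact pow_ne_zero _ ha h1
    · have hX := hsum (X 0 : MvPolynomial (Fin 2) k) (X 1)
      rw [show ![(X 0 : MvPolynomial (Fin 2) k), X 1] = X by
        ext i : 1; fin_cases i <;> rfl, aeval_X_left, AlgHom.id_apply] at hX
      rw [hX]
      refine dvd_mul_of_dvd_right ?_ _
      have e : ∑ m ∈ Q.support, algebraMap k (MvPolynomial (Fin 2) k) (coeff m Q) *
          (C μ * X 1 ^ t) ^ c m * (X 1 ^ t) ^ (L - c m) = 0 := by
        have : ∀ m ∈ Q.support, algebraMap k (MvPolynomial (Fin 2) k) (coeff m Q) *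
          (C μ * X 1 ^ t) ^ c m * (X 1 ^ t) ^ (L - c m) =
            C (coeff m Q * μ ^ c m) * (X 1 ^ t) ^ L := by
          intro m hm
          rw [algebraMap_eq, mul_pow, ← Nat.add_sub_cancel' (hcL m hm), pow_add,
            Nat.add_sub_cancel_left, C_mul, C_pow]
          ring
        rw [Finset.sum_congr rfl this, ← Finset.sum_mul, ← map_sum, h2, C_0, zero_mul]
      rw [← sub_zero (∑ m ∈ Q.support, _), ← e, ← Finset.sum_sub_distrib]
      refine Finset.dvd_sum fun m _ => ?_
      rw [← sub_mul, ← mul_sub]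
      exact ((sub_dvd_pow_sub_pow _ _ _).mul_left _).mul_right _

end ElementaryReduction

section ElementaryReduction

variable {k : Type*} [Field k]

theorem Derivation.conj_iterate {R S : Type*} [CommRing R] [Algebra k R] [CommRing S] [Algebra k S]
    (e : R ≃ₐ[k] S) (d : Derivation k R R) (n : ℕ) (s : S) :
    (d.conj e)^[n] s = e (d^[n] (e.symm s)) := by
  induction n with
  | zero => simp
  | succ n ih => rw [Function.iterate_succ_apply', Function.iterate_succ_apply', ih]; simp

theorem coeff_aeval_eq {α β : ℕ} {x y : Polynomial (Polynomial k)} (hx : x.natDegree = α)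
    (hy : y.natDegree = β) {W : ℕ} {f : MvPolynomial (Fin 2) k}
    (hf : WeightLE ![(α : ℤ), (β : ℤ)] W f) :
    (aeval ![x, y] f).coeff W = aeval ![x.leadingCoeff, y.leadingCoeff]
      (weightedHomogeneousComponent ![(α : ℤ), (β : ℤ)] (W : ℤ) f) := by
  have hmon : ∀ (m : Fin 2 →₀ ℕ) (c : k), Finsupp.weight ![(α : ℤ), (β : ℤ)] m ≤ W →
      (aeval ![x, y] (monomial m c)).coeff W = aeval ![x.leadingCoeff, y.leadingCoeff]
      (weightedHomogeneousComponent ![(α : ℤ), (β : ℤ)] (W : ℤ) (monomial m c)) := by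
    intro m c hm
    have hdeg : (x ^ m 0 * y ^ m 1).natDegree ≤ m 0 * α + m 1 * β :=
      Polynomial.natDegree_mul_le.trans (add_le_add (Polynomial.natDegree_pow_le_of_le _ hx.le)
        (Polynomial.natDegree_pow_le_of_le _ hy.le))
    have e1 : aeval ![x, y] (monomial m c) = Polynomial.C (Polynomial.C c) * (x ^ m 0 * y ^ m 1) := by
      rw [aeval_monomial, Finsupp.prod_fintype _ _ (by simp), Fin.prod_univ_two]
      simp [Polynomial.algebraMap_apply]
    rw [e1, Polynomial.coeff_C_mul]
    rcases hm.lt_or_eq with h | h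
    · rw [(weightLE_monomial m c).component_of_lt h, map_zero (aeval _),
        Polynomial.coeff_eq_zero_of_natDegree_lt, mul_zero]
      rw [weight_fin_two] at h
      norm_cast at h
      lia
    · rw [← h, component_monomial, aeval_monomial, Finsupp.prod_fintype _ _ (by simp),
        Fin.prod_univ_two]
      rw [weight_fin_two] at h
      norm_cast at h
      rw [← h, Polynomial.coeff_mul_add_eq_of_natDegree_le
        (Polynomial.natDegree_pow_le_of_le _ hx.le) (Polynomial.natDegree_pow_le_of_le _ hy.le),
        Polynomial.coeff_pow_of_natDegree_le hx.le, Polynomial.coeff_pow_of_natDegree_le hy.le]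
      simp [Polynomial.leadingCoeff, hx, hy]
  conv_lhs => rw [f.as_sum]
  conv_rhs => rw [f.as_sum]
  rw [map_sum, map_sum, map_sum, Polynomial.finsetSum_coeff]
  exact Finset.sum_congr rfl fun m hm => hmon m _ (hf m (mem_support_iff.mp hm))

variable [CharZero k]

theorem eq_one_or_eq_one_of_dvd {D : Derivation k (MvPolynomial (Fin 2) k) (MvPolynomial (Fin 2) k)}
    (hD : D ≠ 0) (hnil : ∀ f, ∃ n, D^[n] f = 0) {s t : ℕ} {μ : k} (hs : 0 < s) (ht : 0 < t)
    (hμ : μ ≠ 0) {Q : MvPolynomial (Fin 2) k} (hQ : Q ≠ 0) (hDQ : D Q = 0)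
    (hdvd : X 0 ^ s - C μ * X 1 ^ t ∣ Q) : s = 1 ∨ t = 1 := by
  by_contra! hst
  obtain ⟨v, rfl⟩ := hdvd
  have hu := Derivation.eq_zero_of_mul_eq_zero hnil hQ hDQ
  rw [map_sub, Derivation.leibniz_pow, Derivation.leibniz, Derivation.leibniz_pow,
    ← algebraMap_eq, Derivation.map_algebraMap] at hu
  simp only [smul_eq_mul, nsmul_eq_mul, mul_zero, add_zero, algebraMap_eq] at hu
  have hu : C (s : k) * (X 0 ^ (s - 1) * D (X 0)) = C (μ * t) * (X 1 ^ (t - 1) * D (X 1)) := by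
    rw [C_mul, map_natCast, map_natCast]
    linear_combination hu
  have hs0 : (s : k) ≠ 0 := by exact_mod_cast hs.ne'
  have ht0 : μ * (t : k) ≠ 0 := mul_ne_zero hμ (by exact_mod_cast ht.ne')
  have hsC : (C (s : k) : MvPolynomial (Fin 2) k) ≠ 0 := by simpa using hs.ne'
  have htC : (C (μ * t) : MvPolynomial (Fin 2) k) ≠ 0 := by
    rw [Ne, C_eq_zero]; exact ht0
  have hx0 : D (X 0) ≠ 0 := by
    intro h0
    apply hD
    apply derivation_ext
    intro i
    fin_cases i
    · simpa using h0
    · rw [h0, mul_zero, mul_zero, zero_eq_mul, or_iff_right htC, mul_eq_zero,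
        or_iff_right (pow_ne_zero _ (X_ne_zero _))] at hu
      simpa using hu
  have hy0 : D (X 1) ≠ 0 := by
    intro h0
    rw [h0, mul_zero, mul_zero, mul_eq_zero, or_iff_right hsC, mul_eq_zero,
        or_iff_right (pow_ne_zero _ (X_ne_zero _))] at hu
    exact hx0 hu
  have key : ∀ (i j : Fin 2) (a b : k) (m n : ℕ), i ≠ j → a ≠ 0 →
      (C a * (X i ^ m * D (X i)) : MvPolynomial (Fin 2) k) = C b * (X j ^ (n + 1) * D (X j)) →
      (X j : MvPolynomial (Fin 2) k) ∣ D (X i) := by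
    intro i j a b m n hij ha h
    have h1 : (X j : MvPolynomial (Fin 2) k) ∣ C a * (X i ^ m * D (X i)) := by
      rw [h, pow_succ]
      exact ((dvd_mul_left _ _).mul_right _).mul_left _
    have hp : Prime (X j : MvPolynomial (Fin 2) k) := X_prime
    rcases hp.dvd_or_dvd h1 with h2 | h2
    · have hC : IsUnit (C a : MvPolynomial (Fin 2) k) := by
        simpa using ha
      exact absurd (isUnit_of_dvd_unit h2 hC) hp.not_isUnit
    · rcases hp.dvd_or_dvd h2 with h3 | h3
      · have := hp.dvd_of_dvd_pow h3
        rw [X_dvd_X] at this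
        exact absurd this.symm hij
      · exact h3
  refine Derivation.eq_zero_of_dvd_of_dvd hnil hx0 hy0
    (key 0 1 s (μ * t) (s - 1) (t - 2) (by decide) hs0 ?_)
    (key 1 0 (μ * t) s (t - 1) (s - 2) (by decide) ht0 ?_)
  · rw [hu, show t - 2 + 1 = t - 1 by lia]
  · rw [← hu, show s - 2 + 1 = s - 1 by lia]

theorem exists_elementary_reduction
    (Φ : MvPolynomial (Fin 2) k ≃ₐ[k] Polynomial (Polynomial k))
    (h0 : 0 < (Φ (X 0)).natDegree) (h1 : 0 < (Φ (X 1)).natDegree) :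
    (∃ (t : ℕ) (μ : k), (Φ (X 0 - C μ * X 1 ^ t)).natDegree < (Φ (X 0)).natDegree) ∨
      ∃ (t : ℕ) (μ : k), (Φ (X 1 - C μ * X 0 ^ t)).natDegree < (Φ (X 1)).natDegree := by
  set x := Φ (X 0) with hx
  set y := Φ (X 1) with hy
  set α := x.natDegree with hα
  set β := y.natDegree with hβ
  set w : Fin 2 → ℤ := ![(α : ℤ), (β : ℤ)] with hw
  set P := Φ.symm (Polynomial.C Polynomial.X) with hP
  have hΦ : ∀ f, Φ f = aeval ![x, y] f := by
    have : (Φ : MvPolynomial (Fin 2) k →ₐ[k] Polynomial (Polynomial k)) = aeval ![x, y] := by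
      apply algHom_ext
      intro i
      fin_cases i <;> simp [hx, hy]
    exact fun f => congrArg (fun g => g f) this
  have hPΦ : Φ P = Polynomial.C Polynomial.X := by rw [hP, AlgEquiv.apply_symm_apply]
  set δ : Derivation k (Polynomial (Polynomial k)) (Polynomial (Polynomial k)) :=
    (Polynomial.derivative' (R := Polynomial k)).restrictScalars k with h_partial
  have h_apply : ∀ p, δ p = Polynomial.derivative p := fun p => rfl
  set D := δ.conj Φ.symm with hD
  have hnil : ∀ f, ∃ n, D^[n] f = 0 := by
    intro f
    refine ⟨(Φ f).natDegree + 1, ?_⟩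
    rw [hD, Derivation.conj_iterate, map_eq_zero_iff _ Φ.symm.injective]
    exact Polynomial.iterate_derivative_eq_zero (p := Φ f) (Nat.lt_succ_self _)
  have hD0 : D ≠ 0 := by
    intro h
    have := congrArg (fun d => d (Φ.symm Polynomial.X)) h
    simp [hD, h_apply] at this
  have hDP : D P = 0 := by
    rw [hD, Derivation.conj_apply, AlgEquiv.symm_symm, hPΦ, h_apply]
    simp
  obtain ⟨e, he, hT⟩ := exists_topDerivation_ne_zero w hD0
  have hPc : ∀ c, P ≠ C c := by
    intro c hc
    have : Φ P = Polynomial.C (Polynomial.C c) := by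
      rw [hc, ← algebraMap_eq, AlgEquiv.commutes]
      rfl
    rw [hPΦ] at this
    exact Polynomial.X_ne_C _ (Polynomial.C_injective this)
  obtain ⟨m₁, hm₁, hm₁0⟩ : ∃ m ∈ P.support, m ≠ 0 := by
    by_contra! h
    apply hPc (coeff 0 P)
    ext m
    rw [coeff_C]
    split_ifs with hm
    · rw [hm]
    · by_contra h0
      exact hm (h m (mem_support_iff.mpr h0)).symm
  obtain ⟨m₂, hm₂, hmax⟩ := P.support.exists_max_image (fun m => Finsupp.weight w m) ⟨m₁, hm₁⟩
  obtain ⟨W, hW⟩ : ∃ W : ℕ, Finsupp.weight w m₂ = W := by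
    refine ⟨m₂ 0 * α + m₂ 1 * β, ?_⟩
    rw [hw, weight_fin_two]
    push_cast
    rfl
  have hW0 : 0 < W := by
    have := hmax m₁ hm₁
    rw [hW, hw, weight_fin_two] at this
    norm_cast at this
    by_contra hW0
    apply hm₁0
    have hz : m₁ 0 * α + m₁ 1 * β = 0 := by lia
    rw [Nat.add_eq_zero_iff, mul_eq_zero, mul_eq_zero] at hz
    ext i
    fin_cases i
    · simpa using hz.1.resolve_right h0.ne'
    · simpa using hz.2.resolve_right h1.ne'
  have hWP : WeightLE w W P := fun m hm => hW ▸ hmax m (mem_support_iff.mpr hm)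
  set Q := weightedHomogeneousComponent w (W : ℤ) P with hQ
  have hQ0 : Q ≠ 0 := by
    classical
    intro h
    have := congrArg (coeff m₂) h
    rw [hQ, coeff_weightedHomogeneousComponent, if_pos hW, coeff_zero] at this
    exact mem_support_iff.mp hm₂ this
  have hTQ : topDerivation w D e Q = 0 := by
    rw [hQ, ← (topDerivation_component he hWP).2, hDP, map_zero]
  have hQv : aeval ![x.leadingCoeff, y.leadingCoeff] Q = 0 := by
    rw [hQ, ← coeff_aeval_eq hα.symm hβ.symm hWP, ← hΦ, hPΦ, Polynomial.coeff_C_of_ne_zero hW0.ne']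
  have hx0 : x.leadingCoeff ≠ 0 := by
    rw [Ne, Polynomial.leadingCoeff_eq_zero]
    rintro h
    rw [hα, h] at h0; simp at h0
  have hy0 : y.leadingCoeff ≠ 0 := by
    rw [Ne, Polynomial.leadingCoeff_eq_zero]
    rintro h
    rw [hβ, h] at h1; simp at h1
  obtain ⟨s, t, μ, hs, ht, hst, hμ, hdvd, hlead⟩ := exists_dvd_of_isWeightedHomogeneous h0 h1 hQ0
    (weightedHomogeneousComponent_isWeightedHomogeneous _ _) hx0 hy0 hQv
  have hred : ∀ (u v : Polynomial (Polynomial k)) (t : ℕ) (μ : k), 0 < u.natDegree →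
      u.natDegree = t * v.natDegree → u.leadingCoeff = Polynomial.C μ * v.leadingCoeff ^ t →
      (u - Polynomial.C (Polynomial.C μ) * v ^ t).natDegree < u.natDegree := by
    intro u v t μ hu huv hl
    have hle : (u - Polynomial.C (Polynomial.C μ) * v ^ t).natDegree ≤ u.natDegree := by
      refine (Polynomial.natDegree_sub_le _ _).trans (max_le le_rfl ?_)
      exact (Polynomial.natDegree_C_mul_le _ _).trans
        ((Polynomial.natDegree_pow_le).trans huv.ge)
    refine lt_of_le_of_ne hle fun h => ?_
    have hc : (u - Polynomial.C (Polynomial.C μ) * v ^ t).leadingCoeff = 0 := by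
      rw [Polynomial.leadingCoeff, h, Polynomial.coeff_sub, Polynomial.coeff_C_mul]
      conv_lhs => rw [huv, Polynomial.coeff_pow_of_natDegree_le le_rfl, ← huv]
      exact sub_eq_zero.mpr hl
    rw [Polynomial.leadingCoeff_eq_zero] at hc
    rw [hc, Polynomial.natDegree_zero] at h
    lia
  have hCΦ : ∀ c : k, Φ (C c) = Polynomial.C (Polynomial.C c) := by
    intro c
    rw [← algebraMap_eq, AlgEquiv.commutes]
    rfl
  rcases eq_one_or_eq_one_of_dvd hT (topDerivation_nilpotent he hnil) hs ht hμ hQ0 hTQ hdvd with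
    rfl | rfl
  · left
    refine ⟨t, μ, ?_⟩
    rw [map_sub, map_mul, map_pow, hCΦ]
    refine hred x y t μ h0 ?_ ?_
    · rw [← hα, ← hβ, ← hst, one_mul]
    · rw [← hlead, pow_one]
  · right
    refine ⟨s, μ⁻¹, ?_⟩
    rw [map_sub, map_mul, map_pow, hCΦ]
    refine hred y x s μ⁻¹ h1 ?_ ?_
    · rw [← hα, ← hβ, hst, one_mul]
    · rw [hlead, pow_one, ← mul_assoc, ← Polynomial.C_mul, inv_mul_cancel₀ hμ, Polynomial.C_1,
        one_mul]

end ElementaryReduction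

section Jung

variable {k : Type*} [Field k]

theorem algEquiv_ext_fin_two {S : Type*} [CommRing S] [Algebra k S]
    {ρ τ : MvPolynomial (Fin 2) k ≃ₐ[k] S} (h0 : ρ (X 0) = τ (X 0)) (h1 : ρ (X 1) = τ (X 1)) :
    ρ = τ := by
  have : (ρ : MvPolynomial (Fin 2) k →ₐ[k] S) = τ := by
    apply algHom_ext
    intro i
    fin_cases i
    · exact h0
    · exact h1
  ext f
  exact congrArg (fun g => g f) this

/-- The triangular endomorphism `x ↦ a x + b`, `y ↦ c y + q(x)`. -/
def IsTriangular (ρ : MvPolynomial (Fin 2) k ≃ₐ[k] MvPolynomial (Fin 2) k) (a b c : k)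
    (q : Polynomial k) : Prop :=
  ρ (X 0) = C a * X 0 + C b ∧ ρ (X 1) = C c * X 1 + Polynomial.aeval (X 0) q

theorem algEquiv_C (ρ : MvPolynomial (Fin 2) k ≃ₐ[k] MvPolynomial (Fin 2) k) (c : k) :
    ρ (C c) = C c := by
  rw [← algebraMap_eq, AlgEquiv.commutes]

theorem algEquiv_aeval (ρ : MvPolynomial (Fin 2) k ≃ₐ[k] MvPolynomial (Fin 2) k)
    (q : Polynomial k) (f : MvPolynomial (Fin 2) k) :
    ρ (Polynomial.aeval f q) = Polynomial.aeval (ρ f) q :=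
  (Polynomial.aeval_algHom_apply ρ f q).symm

theorem aeval_comp_linear (q : Polynomial k) (a b : k) (f : MvPolynomial (Fin 2) k) :
    Polynomial.aeval (C a * f + C b) q
      = Polynomial.aeval f (q.comp (Polynomial.C a * Polynomial.X + Polynomial.C b)) := by
  rw [Polynomial.aeval_comp]
  simp [algebraMap_eq]

theorem IsTriangular.mul {ρ ρ' : MvPolynomial (Fin 2) k ≃ₐ[k] MvPolynomial (Fin 2) k}
    {a b c a' b' c' : k} {q q' : Polynomial k} (h : IsTriangular ρ a b c q)
    (h' : IsTriangular ρ' a' b' c' q') :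
    IsTriangular (ρ * ρ') (a' * a) (a' * b + b') (c' * c)
      (Polynomial.C c' * q + q'.comp (Polynomial.C a * Polynomial.X + Polynomial.C b)) := by
  constructor
  · rw [AlgEquiv.mul_apply, h'.1, map_add, map_mul, algEquiv_C, algEquiv_C, h.1]
    simp only [C_mul, C_add]
    ring
  · rw [AlgEquiv.mul_apply, h'.2, map_add, map_mul, algEquiv_C, algEquiv_aeval, h.1, h.2,
      aeval_comp_linear]
    simp only [map_add, map_mul, Polynomial.aeval_C, algebraMap_eq]
    ring

theorem exists_isTriangular {a c : k} (b : k) (ha : a ≠ 0) (hc : c ≠ 0) (q : Polynomial k) :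
    ∃ ρ, IsTriangular ρ a b c q := by
  have hC : ∀ r : k, r ≠ 0 →
      (C r : MvPolynomial (Fin 2) k) * C r⁻¹ = 1 := fun r hr => by
    rw [← C_mul, mul_inv_cancel₀ hr, C_1]
  let φ : MvPolynomial (Fin 2) k →ₐ[k] MvPolynomial (Fin 2) k :=
    aeval ![C a * X 0 + C b, C c * X 1 + Polynomial.aeval (X 0) q]
  let ψ : MvPolynomial (Fin 2) k →ₐ[k] MvPolynomial (Fin 2) k :=
    aeval ![C a⁻¹ * (X 0 - C b), C c⁻¹ * (X 1 - Polynomial.aeval (C a⁻¹ * (X 0 - C b)) q)]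
  have hφ0 : φ (X 0) = C a * X 0 + C b := by simp [φ]
  have hφ1 : φ (X 1) = C c * X 1 + Polynomial.aeval (X 0) q := by simp [φ]
  have hψ0 : ψ (X 0) = C a⁻¹ * (X 0 - C b) := by simp [ψ]
  have hψ1 : ψ (X 1) = C c⁻¹ * (X 1 - Polynomial.aeval (C a⁻¹ * (X 0 - C b)) q) := by simp [ψ]
  have hφC : ∀ r, φ (C r) = C r := fun r => by rw [← algebraMap_eq, AlgHom.commutes]
  have hψC : ∀ r, ψ (C r) = C r := fun r => by rw [← algebraMap_eq, AlgHom.commutes]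
  have hφψ : φ (C a⁻¹ * (X 0 - C b)) = X 0 := by
    rw [map_mul, map_sub, hφC, hφC, hφ0]
    linear_combination X 0 * hC a ha
  refine ⟨AlgEquiv.ofAlgHom φ ψ ?_ ?_, hφ0, hφ1⟩
  · apply algHom_ext
    intro i
    fin_cases i
    · change φ (ψ (X 0)) = X 0
      rw [hψ0, hφψ]
    · change φ (ψ (X 1)) = X 1
      rw [hψ1, map_mul, map_sub, ← Polynomial.aeval_algHom_apply, hφψ, hφC, hφ1]
      linear_combination X 1 * hC c hc
  · apply algHom_ext
    intro i
    fin_cases i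
    · change ψ (φ (X 0)) = X 0
      rw [hφ0, map_add, map_mul, hψC, hψC, hψ0]
      linear_combination (X 0 - C b) * hC a ha
    · change ψ (φ (X 1)) = X 1
      rw [hφ1, map_add, map_mul, ← Polynomial.aeval_algHom_apply, hψC, hψ0, hψ1]
      linear_combination (X 1 - Polynomial.aeval (C a⁻¹ * (X 0 - C b)) q) * hC c hc

theorem IsTriangular.ext {ρ ρ' : MvPolynomial (Fin 2) k ≃ₐ[k] MvPolynomial (Fin 2) k} {a b c : k}
    {q : Polynomial k} (h : IsTriangular ρ a b c q) (h' : IsTriangular ρ' a b c q) : ρ = ρ' :=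
  algEquiv_ext_fin_two (h.1.trans h'.1.symm) (h.2.trans h'.2.symm)

theorem isTriangular_one :
    IsTriangular (1 : MvPolynomial (Fin 2) k ≃ₐ[k] MvPolynomial (Fin 2) k) 1 0 1 0 := by
  constructor <;> simp

variable (k) in
/-- The group of triangular automorphisms of the plane. -/
def triangularGroup : Subgroup (MvPolynomial (Fin 2) k ≃ₐ[k] MvPolynomial (Fin 2) k) where
  carrier := {ρ | ∃ a b c q, a ≠ 0 ∧ c ≠ 0 ∧ IsTriangular ρ a b c q}
  one_mem' := ⟨1, 0, 1, 0, one_ne_zero, one_ne_zero, isTriangular_one⟩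
  mul_mem' := by
    rintro ρ ρ' ⟨a, b, c, q, ha, hc, h⟩ ⟨a', b', c', q', ha', hc', h'⟩
    exact ⟨_, _, _, _, mul_ne_zero ha' ha, mul_ne_zero hc' hc, h.mul h'⟩
  inv_mem' := by
    rintro ρ ⟨a, b, c, q, ha, hc, h⟩
    obtain ⟨τ, hτ⟩ := exists_isTriangular (-(a⁻¹ * b)) (inv_ne_zero ha) (inv_ne_zero hc)
      (-(Polynomial.C c⁻¹ * q.comp
        (Polynomial.C a⁻¹ * Polynomial.X + Polynomial.C (-(a⁻¹ * b)))))
    have h1 : τ * ρ = 1 := by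
      refine (hτ.mul h).ext ?_
      have e1 : a * a⁻¹ = 1 := mul_inv_cancel₀ ha
      have e2 : c * c⁻¹ = 1 := mul_inv_cancel₀ hc
      have e3 : a * -(a⁻¹ * b) + b = 0 := by linear_combination (-b) * e1
      have e4 : (Polynomial.C c * -(Polynomial.C c⁻¹ * q.comp
          (Polynomial.C a⁻¹ * Polynomial.X + Polynomial.C (-(a⁻¹ * b)))) +
          q.comp (Polynomial.C a⁻¹ * Polynomial.X + Polynomial.C (-(a⁻¹ * b)))) = 0 := by
        have : Polynomial.C c * Polynomial.C c⁻¹ = 1 := by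
          rw [← Polynomial.C_mul, e2, Polynomial.C_1]
        linear_combination (-q.comp
          (Polynomial.C a⁻¹ * Polynomial.X + Polynomial.C (-(a⁻¹ * b)))) * this
      rw [e1, e2, e3, e4]
      exact isTriangular_one
    rw [inv_eq_of_mul_eq_one_left h1]
    exact ⟨_, _, _, _, inv_ne_zero ha, inv_ne_zero hc, hτ⟩

variable (k) in
/-- The exchange of the two variables. -/
noncomputable def swapVariables : MvPolynomial (Fin 2) k ≃ₐ[k] MvPolynomial (Fin 2) k :=
  renameEquiv k (Equiv.swap 0 1)

@[simp] theorem swapVariables_X_zero : swapVariables k (X 0) = X 1 := by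
  simp [swapVariables]

@[simp] theorem swapVariables_X_one : swapVariables k (X 1) = X 0 := by
  simp [swapVariables]

theorem swapVariables_mul_self : swapVariables k * swapVariables k = 1 :=
  algEquiv_ext_fin_two (by simp) (by simp)

variable (k) in
/-- The affine triangular automorphisms. -/
def affineTriangular : Set (MvPolynomial (Fin 2) k ≃ₐ[k] MvPolynomial (Fin 2) k) :=
  {ρ | ∃ a b c q, a ≠ 0 ∧ c ≠ 0 ∧ q.natDegree ≤ 1 ∧ IsTriangular ρ a b c q}

theorem affineTriangular_subset : affineTriangular k ⊆ triangularGroup k := by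
  rintro ρ ⟨a, b, c, q, ha, hc, -, h⟩
  exact ⟨a, b, c, q, ha, hc, h⟩

theorem swap_mul_affine_mul_swap (ρ) (hρ : ρ ∈ affineTriangular k) :
    swapVariables k * ρ * swapVariables k ∈ triangularGroup k ∨
      ∃ τ ∈ affineTriangular k, ∃ τ' ∈ affineTriangular k,
        swapVariables k * ρ * swapVariables k = τ * swapVariables k * τ' := by
  obtain ⟨a, b, c, q, ha, hc, hq, h⟩ := hρ
  obtain ⟨p, r, rfl⟩ : ∃ p r, q = Polynomial.C p * Polynomial.X + Polynomial.C r :=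
    ⟨_, _, Polynomial.eq_X_add_C_of_natDegree_le_one hq⟩
  have h2 := h.2
  rw [map_add, map_mul, Polynomial.aeval_C, Polynomial.aeval_X, Polynomial.aeval_C,
    algebraMap_eq] at h2
  have e0 : (swapVariables k * ρ * swapVariables k) (X 0) = C c * X 0 + (C p * X 1 + C r) := by
    simp only [AlgEquiv.mul_apply, swapVariables_X_zero, h2, map_add, map_mul, algEquiv_C,
      swapVariables_X_one]
  have e1 : (swapVariables k * ρ * swapVariables k) (X 1) = C a * X 1 + C b := by
    simp only [AlgEquiv.mul_apply, swapVariables_X_zero, h.1, map_add, map_mul, algEquiv_C,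
      swapVariables_X_one]
  by_cases hp : p = 0
  · left
    refine ⟨c, r, a, Polynomial.C b, hc, ha, ?_, ?_⟩
    · rw [e0, hp]; simp
    · rw [e1]; simp [algebraMap_eq]
  · right
    have hdeg : ∀ u v : k, (Polynomial.C u * Polynomial.X + Polynomial.C v).natDegree ≤ 1 :=
      fun u v => Polynomial.natDegree_linear_le
    have hac : -(a * c / p) ≠ 0 := neg_ne_zero.mpr (div_ne_zero (mul_ne_zero ha hc) hp)
    obtain ⟨τ, hτ⟩ := exists_isTriangular 0 one_ne_zero hp
      (Polynomial.C c * Polynomial.X + Polynomial.C r)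
    obtain ⟨τ', hτ'⟩ := exists_isTriangular 0 one_ne_zero hac
      (Polynomial.C (a / p) * Polynomial.X + Polynomial.C (b - a * r / p))
    refine ⟨τ, ⟨_, _, _, _, one_ne_zero, hp, hdeg _ _, hτ⟩, τ',
      ⟨_, _, _, _, one_ne_zero, hac, hdeg _ _, hτ'⟩, ?_⟩
    have t0 := hτ.1
    have t1 := hτ.2
    have t0' := hτ'.1
    have t1' := hτ'.2
    simp only [C_1, C_0, one_mul, add_zero, map_add, map_mul, Polynomial.aeval_C,
      Polynomial.aeval_X, algebraMap_eq] at t0 t1 t0' t1'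
    apply algEquiv_ext_fin_two
    · rw [e0, AlgEquiv.mul_apply, AlgEquiv.mul_apply, t0', swapVariables_X_zero, t1]
      ring
    · rw [e1, AlgEquiv.mul_apply, AlgEquiv.mul_apply, t1']
      simp only [map_add, map_mul, algEquiv_C, swapVariables_X_zero, swapVariables_X_one, t0, t1]
      have i1 : (C (-(a * c / p)) : MvPolynomial (Fin 2) k) = - (C (a / p) * C c) := by
        rw [← C_mul, ← C_neg]; congr 1; ring
      have i2 : (C a : MvPolynomial (Fin 2) k) = C (a / p) * C p := by
        rw [← C_mul, div_mul_cancel₀ _ hp]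
      have i3 : (C (b - a * r / p) : MvPolynomial (Fin 2) k) = C b - C (a / p) * C r := by
        rw [← C_mul, ← C_sub]; congr 1; ring
      rw [i1, i3, i2]
      ring

open Polynomial.Bivariate in
theorem mem_triangularGroup_of_natDegree_eq_zero
    (ρ : MvPolynomial (Fin 2) k ≃ₐ[k] MvPolynomial (Fin 2) k)
    (h : ((equivMvPolynomial k).symm (ρ (X 0))).natDegree = 0) : ρ ∈ triangularGroup k := by
  set Φ := ρ.trans (equivMvPolynomial k).symm with hΦ
  obtain ⟨p, hp⟩ := Polynomial.natDegree_eq_zero.mp h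
  set y := Φ (X 1) with hy
  have hcomp : ∀ f, ∃ F : Polynomial (Polynomial k),
      Φ f = (F.map (Polynomial.compRingHom p)).comp y := by
    intro f
    induction f using MvPolynomial.induction_on with
    | C a =>
      refine ⟨Polynomial.C (Polynomial.C a), ?_⟩
      rw [← algebraMap_eq, AlgEquiv.commutes]
      simp [Polynomial.algebraMap_apply]
    | add f g hf hg =>
      obtain ⟨F, hF⟩ := hf
      obtain ⟨G, hG⟩ := hg
      exact ⟨F + G, by rw [map_add, hF, hG, Polynomial.map_add, Polynomial.add_comp]⟩
    | mul_X f i hf =>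
      obtain ⟨F, hF⟩ := hf
      fin_cases i
      · refine ⟨F * Polynomial.C Polynomial.X, ?_⟩
        rw [map_mul, hF, Polynomial.map_mul, Polynomial.mul_comp]
        congr 1
        change (equivMvPolynomial k).symm (ρ (X 0)) = _
        rw [← hp]
        simp
      · refine ⟨F * Polynomial.X, ?_⟩
        rw [map_mul, hF, Polynomial.map_mul, Polynomial.mul_comp]
        simp [hy]
  obtain ⟨F, hF⟩ := hcomp (Φ.symm Polynomial.X)
  obtain ⟨G, hG⟩ := hcomp (Φ.symm (Polynomial.C Polynomial.X))
  rw [AlgEquiv.apply_symm_apply] at hF hG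
  have hdF := congrArg Polynomial.natDegree hF
  have hdG := congrArg Polynomial.natDegree hG
  rw [Polynomial.natDegree_X, Polynomial.natDegree_comp, eq_comm, mul_eq_one] at hdF
  rw [Polynomial.natDegree_C, Polynomial.natDegree_comp, hdF.2, mul_one, eq_comm] at hdG
  obtain ⟨g, hg⟩ := Polynomial.natDegree_eq_zero.mp hdG
  have hcoeff : g = (G.coeff 0).comp p := by
    have := congrArg (fun P => Polynomial.coeff P 0) hg
    simpa using this
  rw [← hg, Polynomial.C_comp] at hG
  have hpX := congrArg Polynomial.natDegree (Polynomial.C_injective hG)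
  rw [Polynomial.natDegree_X, hcoeff, Polynomial.natDegree_comp, eq_comm,
    mul_eq_one] at hpX
  have hp1 := Polynomial.eq_X_add_C_of_natDegree_le_one hpX.2.le
  have hy1 := Polynomial.eq_X_add_C_of_natDegree_le_one hdF.2.le
  have ha : p.coeff 1 ≠ 0 := by
    intro h0
    rw [h0] at hp1
    have := hpX.2
    rw [hp1] at this
    simp at this
  have hlead : IsUnit (y.coeff 1) := by
    have h1 := congrArg Polynomial.leadingCoeff hF
    rw [Polynomial.leadingCoeff_X, Polynomial.leadingCoeff_comp (by rw [hdF.2]; exact one_ne_zero),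
      hdF.1, pow_one] at h1
    rw [← hdF.2]
    exact IsUnit.of_mul_eq_one _ (by rw [mul_comm]; exact h1.symm)
  obtain ⟨γ, hγ, hγ'⟩ := Polynomial.isUnit_iff.mp hlead
  refine ⟨p.coeff 1, p.coeff 0, γ, y.coeff 0, ha, hγ.ne_zero, ?_, ?_⟩
  · apply (equivMvPolynomial k).symm.injective
    rw [← hp]
    conv_lhs => rw [hp1]
    simp
  · apply (equivMvPolynomial k).symm.injective
    have e : (equivMvPolynomial k).symm (Polynomial.aeval (X 0) (y.coeff 0)) =
        Polynomial.C (y.coeff 0) := by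
      have : (Polynomial.aeval ((equivMvPolynomial k).symm (X 0)) : Polynomial k →ₐ[k] _) =
          (Algebra.ofId (Polynomial k) (Polynomial (Polynomial k))).restrictScalars k := by
        apply Polynomial.algHom_ext
        simp [Algebra.ofId_apply]
      have := congrArg (fun g => g (y.coeff 0)) this
      rw [Polynomial.aeval_algHom_apply] at this
      exact this
    rw [map_add, e, map_mul, equivMvPolynomial_symm_C, equivMvPolynomial_symm_X_1, hγ']
    exact hy1

open Polynomial.Bivariate in
/-- Jung's theorem. -/
theorem exists_isWord [CharZero k] (ρ : MvPolynomial (Fin 2) k ≃ₐ[k] MvPolynomial (Fin 2) k) :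
    ∃ n, IsWord (swapVariables k) (triangularGroup k) n ρ := by
  obtain ⟨N, hN⟩ : ∃ N, ((equivMvPolynomial k).symm (ρ (X 0))).natDegree +
      ((equivMvPolynomial k).symm (ρ (X 1))).natDegree ≤ N := ⟨_, le_rfl⟩
  induction N using Nat.strong_induction_on generalizing ρ with
  | _ N ih =>
  have hss := swapVariables_mul_self (k := k)
  by_cases h0 : ((equivMvPolynomial k).symm (ρ (X 0))).natDegree = 0
  · exact ⟨0, IsWord.of_mem (mem_triangularGroup_of_natDegree_eq_zero ρ h0)⟩
  by_cases h1 : ((equivMvPolynomial k).symm (ρ (X 1))).natDegree = 0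
  · refine ⟨1, ?_⟩
    have := (IsWord.of_mem (s := swapVariables k) (mem_triangularGroup_of_natDegree_eq_zero
      (ρ * swapVariables k) (by rwa [AlgEquiv.mul_apply, swapVariables_X_zero]))).mul_swap
    rwa [mul_assoc, hss, mul_one] at this
  have elem : ∀ (t : ℕ) (μ : k), ∃ ε ∈ triangularGroup k, ε (X 0) = X 0 ∧
      ε (X 1) = X 1 - C μ * X 0 ^ t := by
    intro t μ
    obtain ⟨ε, hε⟩ := exists_isTriangular (0 : k) one_ne_zero one_ne_zero
      (-(Polynomial.C μ * Polynomial.X ^ t))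
    refine ⟨ε, ⟨_, _, _, _, one_ne_zero, one_ne_zero, hε⟩, ?_, ?_⟩
    · rw [hε.1]; simp
    · rw [hε.2]; simp [algebraMap_eq, sub_eq_add_neg]
  rcases exists_elementary_reduction (ρ.trans (equivMvPolynomial k).symm) (Nat.pos_of_ne_zero h0)
    (Nat.pos_of_ne_zero h1) with ⟨t, μ, h⟩ | ⟨t, μ, h⟩
  · obtain ⟨ε, hε, hε0, hε1⟩ := elem t μ
    set s := swapVariables k with hs
    have e0 : (ρ * (s * ε * s)) (X 0) = ρ (X 0 - C μ * X 1 ^ t) := by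
      simp only [AlgEquiv.mul_apply, hs, swapVariables_X_zero, hε1, map_sub, map_mul, map_pow,
        swapVariables_X_one, algEquiv_C]
    have e1 : (ρ * (s * ε * s)) (X 1) = ρ (X 1) := by
      simp only [AlgEquiv.mul_apply, hs, swapVariables_X_zero, hε0, swapVariables_X_one]
    obtain ⟨n, hn⟩ := ih _ (lt_of_lt_of_le (Nat.add_lt_add_right h _) hN) (ρ * (s * ε * s))
      (by rw [e0, e1]; rfl)
    have := (hn.mul_swap.mul_right (inv_mem hε)).mul_swap
    refine ⟨n + 1 + 1, ?_⟩
    convert this using 1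
    simp only [mul_assoc, hss, mul_inv_cancel_left, mul_one]
  · obtain ⟨ε, hε, hε0, hε1⟩ := elem t μ
    have e0 : (ρ * ε) (X 0) = ρ (X 0) := by rw [AlgEquiv.mul_apply, hε0]
    have e1 : (ρ * ε) (X 1) = ρ (X 1 - C μ * X 0 ^ t) := by rw [AlgEquiv.mul_apply, hε1]
    obtain ⟨n, hn⟩ := ih _ (lt_of_lt_of_le (Nat.add_lt_add_left h _) hN) (ρ * ε)
      (by rw [e0, e1]; rfl)
    refine ⟨n, ?_⟩
    have := hn.mul_right (inv_mem hε)
    rwa [mul_assoc, mul_inv_cancel, mul_one] at this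

end Jung

section FinitePolynomialMaps

variable {ι k : Type*} [Finite ι] [Field k] {δ : ι → ℕ} {c : ι → k} {L : ι → MvPolynomial ι k}

theorem mem_span_monomial_of_triangular_degree (hδ : ∀ j, 0 < δ j) (hc : ∀ j, c j ≠ 0)
    (hL : ∀ j, (L j).totalDegree < δ j) (B : Subalgebra k (MvPolynomial ι k))
    (hB : ∀ j, C (c j) * X j ^ δ j + L j ∈ B) (n : ℕ) (f : MvPolynomial ι k)
    (hf : f.totalDegree < n) :
    f ∈ Submodule.span B ((fun e => monomial e (1 : k)) '' Set.Iic (Finsupp.equivFunOnFinite.symm δ)) := by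
  induction n generalizing f with
  | zero => simp at hf
  | succ n ih =>
    set N := Submodule.span B ((fun e => monomial e (1 : k)) ''
      Set.Iic (Finsupp.equivFunOnFinite.symm δ)) with hN
    have hCN : ∀ (a : k) (g : MvPolynomial ι k), g ∈ N → C a * g ∈ N := fun a g hg =>
      N.smul_mem (⟨C a, B.algebraMap_mem a⟩ : B) hg
    suffices h : ∀ e : ι →₀ ℕ, e.degree ≤ n → monomial e (1 : k) ∈ N by
      rw [f.as_sum]
      refine Submodule.sum_mem _ fun e he => ?_
      have := hCN (coeff e f) _ (h e ((le_totalDegree he).trans (Nat.lt_succ_iff.mp hf)))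
      rwa [C_mul_monomial, mul_one] at this
    intro e he
    by_cases hle : e ≤ Finsupp.equivFunOnFinite.symm δ
    · exact Submodule.subset_span ⟨e, hle, rfl⟩
    · obtain ⟨j, hj⟩ : ∃ j, δ j < e j := by
        rw [Finsupp.le_def] at hle
        push Not at hle
        exact hle
      obtain ⟨e', rfl⟩ : ∃ e', e = e' + Finsupp.single j (δ j) :=
        ⟨e - Finsupp.single j (δ j), (tsub_add_cancel_of_le (by simpa using hj.le)).symm⟩
      have hdeg : e'.degree + δ j ≤ n := by
        rw [map_add, Finsupp.degree_single] at he
        exact he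
      have hmd : (monomial e' (1 : k)).totalDegree ≤ e'.degree := by
        rw [totalDegree_monomial _ one_ne_zero]
        rfl
      have e1 : monomial (e' + Finsupp.single j (δ j)) (1 : k)
          = C (c j)⁻¹ * ((C (c j) * X j ^ δ j + L j) * monomial e' 1 - L j * monomial e' 1) := by
        have h1 : (C (c j)⁻¹ : MvPolynomial ι k) * C (c j) = 1 := by
          rw [← C_mul, inv_mul_cancel₀ (hc j), C_1]
        have h2 : monomial (e' + Finsupp.single j (δ j)) (1 : k) = monomial e' 1 * X j ^ δ j := by
          rw [X_pow_eq_monomial, monomial_mul, one_mul]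
        rw [h2]
        linear_combination (-(monomial e' 1 * X j ^ δ j)) * h1
      rw [e1]
      refine hCN _ _ (N.sub_mem ?_ ?_)
      · refine N.smul_mem (⟨_, hB j⟩ : B) (ih _ ?_)
        have := hδ j
        lia
      · refine ih _ ((totalDegree_mul _ _).trans_lt ?_)
        have := hL j
        lia

theorem span_range_ne_top_of_triangular_degree (hδ : ∀ j, 0 < δ j) (hc : ∀ j, c j ≠ 0)
    (hL : ∀ j, (L j).totalDegree < δ j) :
    Ideal.span (Set.range fun j => C (c j) * X j ^ δ j + L j) ≠ ⊤ := by
  classical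
  set G : ι → MvPolynomial ι k := fun j => C (c j) * X j ^ δ j + L j with hG
  let B := Algebra.adjoin k (Set.range G)
  have hGB : ∀ j, G j ∈ B := fun j => Algebra.subset_adjoin ⟨j, rfl⟩
  have hfin : Module.Finite B (MvPolynomial ι k) := by
    refine ⟨?_⟩
    have hS : ((fun e => monomial e (1 : k)) ''
        Set.Iic (Finsupp.equivFunOnFinite.symm δ)).Finite := by
      rw [← Set.Icc_bot]
      exact (Set.finite_Icc _ _).image _
    rw [Submodule.fg_def]
    refine ⟨_, hS, ?_⟩
    rw [eq_top_iff]
    intro f _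
    exact mem_span_monomial_of_triangular_degree hδ hc hL B hGB _ f (Nat.lt_succ_self _)
  have h_int : Algebra.IsIntegral B (MvPolynomial ι k) := inferInstance
  have halg : Algebra.IsAlgebraic B (MvPolynomial ι k) := inferInstance
  have hind : AlgebraicIndependent k G := by
    refine (Algebra.IsAlgebraic.isTranscendenceBasis_of_lift_le_trdeg_of_finite k G ?_).1
    rw [MvPolynomial.trdeg_of_isDomain]
    simp
  let ψ : B →ₐ[k] k := (aeval (fun _ : ι => (0 : k))).comp hind.aevalEquiv.symm.toAlgHom
  have hψ : ∀ j, ψ ⟨G j, hGB j⟩ = 0 := by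
    intro j
    have : hind.aevalEquiv (X j) = ⟨G j, hGB j⟩ := by
      apply Subtype.ext
      simp
    rw [← this]
    simp [ψ]
  have hmax : (RingHom.ker ψ).IsMaximal := RingHom.ker_isMaximal_of_surjective ψ fun a =>
    ⟨algebraMap k B a, by simp⟩
  obtain ⟨Q, hQ, hQc⟩ := Ideal.exists_ideal_over_maximal_of_isIntegral (S := MvPolynomial ι k)
    (RingHom.ker ψ) (by
      rw [(RingHom.injective_iff_ker_eq_bot _).mp (FaithfulSMul.algebraMap_injective B _)]
      exact bot_le)
  have hle : Ideal.span (Set.range G) ≤ Q := by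
    rw [Ideal.span_le]
    rintro _ ⟨j, rfl⟩
    have : (⟨G j, hGB j⟩ : B) ∈ Q.comap (algebraMap B (MvPolynomial ι k)) := by
      rw [hQc]
      exact hψ j
    exact this
  intro htop
  exact hQ.ne_top (top_le_iff.mp (htop ▸ hle))

end FinitePolynomialMaps

section FixedPoints

variable {k : Type*} [Field k]

/-- The ideal of the fixed point scheme of an automorphism. -/
def fixIdeal {R : Type*} [CommRing R] [Algebra k R] (ρ : R ≃ₐ[k] R) : Ideal R :=
  Ideal.span (Set.range fun f => ρ f - f)

theorem apply_eq_of_fixIdeal_ne_top {R : Type*} [CommRing R] [Algebra k R] {d : Derivation k R R}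
    (hd : DSimple d) {ρ : R ≃ₐ[k] R} (hρ : ∀ f, ρ (d f) = d (ρ f)) (h : fixIdeal ρ ≠ ⊤) (f : R) :
    ρ f = f := by
  have hstable : ∀ g ∈ fixIdeal ρ, d g ∈ fixIdeal ρ := by
    intro g hg
    induction hg using Submodule.span_induction with
    | mem g hg =>
      obtain ⟨f, rfl⟩ := hg
      exact Ideal.subset_span ⟨d f, by simp [hρ]⟩
    | zero => simp
    | add g g' _ _ hg hg' => rw [map_add]; exact add_mem hg hg'
    | smul a g hg hg' =>
      rw [smul_eq_mul, Derivation.leibniz]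
      exact add_mem (Ideal.mul_mem_left _ _ hg') (Ideal.mul_mem_right _ _ hg)
  have hbot := (hd _ hstable).resolve_right h
  have : ρ f - f ∈ fixIdeal ρ := Ideal.subset_span ⟨f, rfl⟩
  rw [hbot, Ideal.mem_bot] at this
  exact sub_eq_zero.mp this

theorem fixIdeal_ne_top {R S : Type*} [CommRing R] [Algebra k R] [CommRing S] [Algebra k S]
    [Nontrivial S] {ρ : R ≃ₐ[k] R} (φ : R →ₐ[k] S) (h : ∀ f, φ (ρ f) = φ f) : fixIdeal ρ ≠ ⊤ := by
  intro htop
  have hle : fixIdeal ρ ≤ RingHom.ker φ := by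
    rw [fixIdeal, Ideal.span_le]
    rintro _ ⟨f, rfl⟩
    simp [RingHom.mem_ker, h]
  have : (1 : R) ∈ RingHom.ker φ := hle (htop ▸ Submodule.mem_top)
  rw [RingHom.mem_ker, map_one] at this
  exact one_ne_zero this

theorem fixIdeal_ne_top_of_X {S : Type*} [CommRing S] [Algebra k S] [Nontrivial S]
    {ρ : MvPolynomial (Fin 2) k ≃ₐ[k] MvPolynomial (Fin 2) k}
    (φ : MvPolynomial (Fin 2) k →ₐ[k] S) (h0 : φ (ρ (X 0)) = φ (X 0))
    (h1 : φ (ρ (X 1)) = φ (X 1)) : fixIdeal ρ ≠ ⊤ := by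
  refine fixIdeal_ne_top φ fun f => ?_
  have : φ.comp (ρ : MvPolynomial (Fin 2) k →ₐ[k] MvPolynomial (Fin 2) k) = φ := by
    apply algHom_ext
    intro i
    fin_cases i
    · exact h0
    · exact h1
  exact congrArg (fun g => g f) this

theorem exists_aeval_X_eq_leading_add {ι : Type*} (q : Polynomial k)
    (hq : 0 < q.natDegree) (j : ι) :
    ∃ L : MvPolynomial ι k, L.totalDegree < q.natDegree ∧
      Polynomial.aeval (X j) q = C q.leadingCoeff * X j ^ q.natDegree + L := by
  refine ⟨Polynomial.aeval (X j) q.eraseLead, ?_, ?_⟩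
  · rw [Polynomial.aeval_eq_sum_range]
    refine (totalDegree_finsetSum _ _).trans_lt ?_
    rw [Finset.sup_lt_iff hq]
    intro i hi
    rw [smul_eq_C_mul]
    refine (totalDegree_mul _ _).trans_lt ?_
    rw [totalDegree_C, totalDegree_X_pow]
    have := Finset.mem_range.mp hi
    have h2 := Polynomial.eraseLead_natDegree_le q
    lia
  · have := congrArg (Polynomial.aeval (X j : MvPolynomial ι k))
      (Polynomial.eraseLead_add_C_mul_X_pow q)
    rw [← this, map_add, map_mul, Polynomial.aeval_C, map_pow, Polynomial.aeval_X, algebraMap_eq,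
      add_comm]

/-- A product of Hénon maps has a fixed point. -/
theorem fixIdeal_henon_ne_top (l : List (MvPolynomial (Fin 2) k ≃ₐ[k] MvPolynomial (Fin 2) k))
    (hl : l ≠ []) (h : ∀ x ∈ l, x ∈ triangularGroup k ∧ x ∉ affineTriangular k) :
    fixIdeal (l.map (· * swapVariables k)).prod ≠ ⊤ := by
  set m := l.length with hm
  have : NeZero m := ⟨by simpa [hm] using hl⟩
  have hdata : ∀ i : Fin m, ∃ a b c q, 1 < q.natDegree ∧ IsTriangular (l[i]) a b c q := by
    intro i
    obtain ⟨⟨a, b, c, q, ha, hc, hq⟩, hA⟩ := h l[i] (List.getElem_mem _)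
    refine ⟨a, b, c, q, ?_, hq⟩
    by_contra hle
    exact hA ⟨a, b, c, q, ha, hc, not_lt.mp hle, hq⟩
  choose a b c q hq ht using hdata
  choose L hL hLq using fun i : Fin m =>
    exists_aeval_X_eq_leading_add (q i) (by have := hq i; lia) i
  let v : Fin m → MvPolynomial (Fin m) k := fun i => C (a (i - 1)) * X (i - 1) + C (b (i - 1))
  let L' : Fin m → MvPolynomial (Fin m) k := fun i => L i + C (c i) * v i - X (i + 1)
  have hv : ∀ i, (v i).totalDegree ≤ 1 := by
    intro i
    refine (totalDegree_add _ _).trans (max_le ((totalDegree_mul _ _).trans ?_) (by simp))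
    simp
  have hL' : ∀ i, (L' i).totalDegree < (q i).natDegree := by
    intro i
    have := hq i
    refine (totalDegree_sub _ _).trans_lt (max_lt ((totalDegree_add _ _).trans_lt
      (max_lt (hL i) ((totalDegree_mul _ _).trans_lt ?_))) ?_)
    · have := hv i
      rw [totalDegree_C]
      lia
    · rw [totalDegree_X]
      exact this
  have hne := span_range_ne_top_of_triangular_degree (δ := fun i => (q i).natDegree)
    (c := fun i => (q i).leadingCoeff) (L := L') (fun i => by have := hq i; lia) (fun i => by
      rw [Ne, Polynomial.leadingCoeff_eq_zero]
      rintro h0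
      have := hq i
      simp [h0] at this) hL'
  set I := Ideal.span (Set.range fun j => C (q j).leadingCoeff * X j ^ (q j).natDegree + L' j)
    with hI
  have : Nontrivial (MvPolynomial (Fin m) k ⧸ I) := Ideal.Quotient.nontrivial_iff.mpr hne
  let π := Ideal.Quotient.mkₐ k I
  have hπ : ∀ i, π (Polynomial.aeval (X i) (q i) + C (c i) * v i) = π (X (i + 1)) := by
    intro i
    rw [← sub_eq_zero, ← map_sub]
    have : (C (q i).leadingCoeff * X i ^ (q i).natDegree + L' i) ∈ I :=
      Ideal.subset_span ⟨i, rfl⟩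
    rw [hLq]
    convert Ideal.Quotient.eq_zero_iff_mem.mpr this using 1
    rw [Ideal.Quotient.mkₐ_eq_mk]
    congr 1
    simp only [L']
    ring
  let φ : Fin m → MvPolynomial (Fin 2) k →ₐ[k] (MvPolynomial (Fin m) k ⧸ I) := fun i =>
    π.comp (aeval ![X i, v i])
  have hφ0 : ∀ i, φ i (X 0) = π (X i) := fun i => by simp [φ]
  have hφ1 : ∀ i, φ i (X 1) = π (v i) := fun i => by simp [φ]
  have hφC : ∀ i r, φ i (C r) = π (C r) := fun i r => by
    rw [← algebraMap_eq, ← algebraMap_eq, AlgHom.commutes, AlgHom.commutes]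
  have hstep : ∀ i f, φ i ((l[i] * swapVariables k) f) = φ (i + 1) f := by
    intro i f
    have : (φ i).comp ((l[i] * swapVariables k : _ ≃ₐ[k] _) :
        MvPolynomial (Fin 2) k →ₐ[k] MvPolynomial (Fin 2) k) = φ (i + 1) := by
      apply algHom_ext
      intro j
      fin_cases j
      · change φ i (l[i] (swapVariables k (X 0))) = φ (i + 1) (X 0)
        rw [swapVariables_X_zero, (ht i).2, hφ0, ← hπ, map_add, map_add, map_mul, map_mul, hφC,
          hφ1, ← Polynomial.aeval_algHom_apply, ← Polynomial.aeval_algHom_apply, hφ0, add_comm]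
      · change φ i (l[i] (swapVariables k (X 1))) = φ (i + 1) (X 1)
        rw [swapVariables_X_one, (ht i).1, hφ1, map_add, map_mul, hφC, hφC, hφ0]
        simp [v]
    exact congrArg (fun g => g f) this
  have hchain : ∀ j ≤ m, ∀ f, φ 0 (((l.take j).map (· * swapVariables k)).prod f)
      = φ (Fin.ofNat m j) f := by
    intro j
    induction j with
    | zero => intro _ f; simp
    | succ j ih =>
      intro hj f
      have hj' : j < l.length := hj
      rw [List.take_add_one, List.getElem?_eq_getElem hj', Option.toList_some, List.map_append,
        List.prod_append, AlgEquiv.mul_apply, ih (by lia)]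
      have e1 : (Fin.ofNat m j) = ⟨j, hj'⟩ := by
        apply Fin.ext
        exact Nat.mod_eq_of_lt hj'
      have e2 : (Fin.ofNat m (j + 1)) = (⟨j, hj'⟩ : Fin m) + 1 := by
        apply Fin.ext
        simp [Fin.val_add]
      have := hstep ⟨j, hj'⟩ f
      rw [e2, ← this, e1]
      simp
  refine fixIdeal_ne_top (φ 0) fun f => ?_
  have := hchain m le_rfl f
  rw [List.take_of_length_le le_rfl] at this
  rw [this]
  congr 2
  apply Fin.ext
  simp

end FixedPoints

section Shift

variable {k : Type*} [Field k] [CharZero k]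

theorem Polynomial.exists_shift_eq {β : k} (hβ : β ≠ 0) (γ : k) (q : Polynomial k) :
    ∃ Q : Polynomial k,
      Q.comp (Polynomial.X + Polynomial.C β) - Polynomial.C γ * Q = q := by
  have hlead : ∀ n : ℕ, ∃ P : Polynomial k, ∀ m, n ≤ m →
      (P.comp (Polynomial.X + Polynomial.C β) - Polynomial.C γ * P).coeff m
        = if m = n then 1 else 0 := by
    intro n
    by_cases hγ : γ = 1
    · have hn : ((n : k) + 1) ≠ 0 := Nat.cast_add_one_ne_zero n
      refine ⟨Polynomial.C (((n : k) + 1) * β)⁻¹ * Polynomial.X ^ (n + 1), fun m hm => ?_⟩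
      rw [hγ, Polynomial.mul_comp, Polynomial.C_comp, Polynomial.X_pow_comp, Polynomial.C_1,
        one_mul, ← mul_sub, Polynomial.coeff_C_mul, Polynomial.coeff_sub,
        Polynomial.coeff_X_add_C_pow, Polynomial.coeff_X_pow]
      rcases hm.eq_or_lt with rfl | hm
      · simp
        field_simp
      · rw [if_neg hm.ne']
        rcases (Nat.succ_le_of_lt hm).eq_or_lt with rfl | hm
        · simp
        · rw [Nat.choose_eq_zero_of_lt hm, if_neg (by lia)]
          simp
    · have h1 : 1 - γ ≠ 0 := sub_ne_zero.mpr (Ne.symm hγ)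
      refine ⟨Polynomial.C (1 - γ)⁻¹ * Polynomial.X ^ n, fun m hm => ?_⟩
      rw [Polynomial.mul_comp, Polynomial.C_comp, Polynomial.X_pow_comp, mul_left_comm, ← mul_sub,
        Polynomial.coeff_C_mul, Polynomial.coeff_sub, Polynomial.coeff_X_add_C_pow,
        Polynomial.coeff_C_mul, Polynomial.coeff_X_pow]
      rcases hm.eq_or_lt with rfl | hm
      · simp [h1]
      · rw [Nat.choose_eq_zero_of_lt hm, if_neg (by lia)]
        simp
  have main : ∀ (n : ℕ) (q : Polynomial k), q.degree < n → ∃ Q : Polynomial k,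
      Q.comp (Polynomial.X + Polynomial.C β) - Polynomial.C γ * Q = q := by
    intro n
    induction n with
    | zero =>
      intro q hq
      refine ⟨0, ?_⟩
      have : q = 0 := by simpa using hq
      simp [this]
    | succ n ih =>
      intro q hq
      obtain ⟨P, hP⟩ := hlead n
      obtain ⟨Q, hQ⟩ := ih (q - Polynomial.C (q.coeff n) *
          (P.comp (Polynomial.X + Polynomial.C β) - Polynomial.C γ * P)) (by
        rw [Polynomial.degree_lt_iff_coeff_zero] at hq ⊢
        intro m hm
        rw [Polynomial.coeff_sub, Polynomial.coeff_C_mul, hP m hm]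
        rcases hm.eq_or_lt with rfl | hm
        · simp
        · rw [hq m hm, if_neg hm.ne']
          simp)
      refine ⟨Q + Polynomial.C (q.coeff n) * P, ?_⟩
      rw [Polynomial.add_comp, Polynomial.mul_comp, Polynomial.C_comp]
      linear_combination hQ
  exact main (q.natDegree + 1) q (Polynomial.degree_lt_iff_coeff_zero _ _ |>.mpr fun m hm =>
    Polynomial.coeff_eq_zero_of_natDegree_lt (by lia))

theorem Polynomial.natDegree_eq_zero_of_comp_X_add_C {β : k} (hβ : β ≠ 0) {c : k}
    {F : Polynomial k} (h : F.comp (Polynomial.X + Polynomial.C β) = Polynomial.C c * F) :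
    F.natDegree = 0 := by
  by_cases hF : F = 0
  · simp [hF]
  have hc : c = 1 := by
    have hd : (Polynomial.X + Polynomial.C β).natDegree = 1 := Polynomial.natDegree_X_add_C β
    have := congrArg Polynomial.leadingCoeff h
    rw [Polynomial.leadingCoeff_comp (by rw [hd]; exact one_ne_zero),
      (Polynomial.monic_X_add_C β).leadingCoeff, one_pow, mul_one, Polynomial.leadingCoeff_mul,
      Polynomial.leadingCoeff_C] at this
    exact (mul_eq_right₀ (Polynomial.leadingCoeff_ne_zero.mpr hF)).mp this.symm
  rw [hc, Polynomial.C_1, one_mul] at h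
  have heval : ∀ n : ℕ, F.eval (n * β) = F.eval 0 := by
    intro n
    induction n with
    | zero => simp
    | succ n ih =>
      have := congrArg (Polynomial.eval (n * β)) h
      rw [Polynomial.eval_comp, ih] at this
      rw [← this]
      congr 1
      simp
      ring
  have hFC : F = Polynomial.C (F.eval 0) := by
    apply Polynomial.eq_of_infinite_eval_eq
    apply Set.infinite_of_injective_forall_mem (f := fun n : ℕ => (n : k) * β)
    · intro n m hnm
      exact Nat.cast_injective (mul_right_cancel₀ hβ hnm)
    · intro n
      simp [heval]
  rw [hFC, Polynomial.natDegree_C]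

end Shift

section Rigidity

variable {k : Type*} [Field k]

/-- Commuting with a simple derivation without nonconstant constant-derivative elements forces
the automorphism to be trivial. -/
def IsRigid {R : Type*} [CommRing R] [Algebra k R] (ρ : R ≃ₐ[k] R) : Prop :=
  ∀ d : Derivation k R R, DSimple d → ConstPrimitive d → (∀ f, ρ (d f) = d (ρ f)) → ρ = 1

variable {R : Type*} [CommRing R] [Algebra k R]

theorem ConstPrimitive.conj {d : Derivation k R R} (hc : ConstPrimitive d) (σ : R ≃ₐ[k] R) :
    ConstPrimitive (d.conj σ) := by
  intro f c hf
  obtain ⟨e, he⟩ := hc (σ.symm f) c (by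
    apply σ.injective
    rw [AlgEquiv.commutes]
    exact hf)
  refine ⟨e, ?_⟩
  rw [← AlgEquiv.commutes σ, ← he, AlgEquiv.apply_symm_apply]

theorem IsRigid.of_mul_eq {ρ τ σ : R ≃ₐ[k] R} (h : τ * σ = σ * ρ) (hτ : IsRigid τ) :
    IsRigid ρ := by
  intro d hd hc hρ
  have hfun : ∀ f, τ (σ f) = σ (ρ f) := fun f => congrArg (fun g => g f) h
  have := hτ (d.conj σ) (hd.conj σ) (hc.conj σ) (by
    intro f
    obtain ⟨f, rfl⟩ := σ.surjective f
    simp only [Derivation.conj_apply, hfun, hρ, AlgEquiv.symm_apply_apply])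
  rw [this, one_mul] at h
  exact mul_left_cancel (a := σ) (by rw [← h, mul_one])

theorem IsRigid.of_isConj {ρ τ : R ≃ₐ[k] R} (h : IsConj ρ τ) (hτ : IsRigid τ) : IsRigid ρ := by
  obtain ⟨σ, rfl⟩ := isConj_iff.mp h
  exact hτ.of_mul_eq (σ := σ) (by group)

theorem isRigid_of_fixIdeal_ne_top {ρ : R ≃ₐ[k] R} (h : fixIdeal ρ ≠ ⊤) : IsRigid ρ :=
  fun _ hd _ hρ => AlgEquiv.ext fun f => apply_eq_of_fixIdeal_ne_top hd hρ h f

theorem derivation_X_ne_aeval {d : Derivation k (MvPolynomial (Fin 2) k) (MvPolynomial (Fin 2) k)}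
    (hd : DSimple d) (hc : ConstPrimitive d) (i : Fin 2) (p : Polynomial k) :
    d (X i) ≠ Polynomial.aeval (X i) p := by
  intro h
  have hconst : ∀ c, d (X i) ≠ algebraMap k _ c := by
    intro c hc'
    obtain ⟨e, he⟩ := hc _ c hc'
    exact X_ne_C i e he
  have hinj : Function.Injective (Polynomial.aeval (R := k) (X i : MvPolynomial (Fin 2) k)) :=
    (transcendental_iff_injective).mp (transcendental_X k i)
  have hp : p ≠ 0 := by
    rintro rfl
    exact hconst 0 (by simpa using h)
  have h0 : Polynomial.aeval (X i : MvPolynomial (Fin 2) k) p ≠ 0 := fun h' =>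
    hp (hinj (by rw [h', map_zero]))
  have hu := hd.isUnit_of_dvd h0 (by
    rw [Derivation.map_aeval, smul_eq_mul, h]
    exact dvd_mul_left _ _)
  rw [MvPolynomial.isUnit_iff_eq_C_of_isReduced] at hu
  obtain ⟨c, -, hc'⟩ := hu
  exact hconst c (by rw [h, hc']; rfl)

end Rigidity

section TriangularRigidity

variable {k : Type*} [Field k]

open Polynomial.Bivariate in
theorem IsTriangular.bivariate_apply
    {ρ : MvPolynomial (Fin 2) k ≃ₐ[k] MvPolynomial (Fin 2) k} {a b c : k} {q : Polynomial k}
    (h : IsTriangular ρ a b c q) (f : MvPolynomial (Fin 2) k) :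
    (equivMvPolynomial k).symm (ρ f) = (((equivMvPolynomial k).symm f).map
      (Polynomial.compRingHom (Polynomial.C a * Polynomial.X + Polynomial.C b))).comp
        (Polynomial.C (Polynomial.C c) * Polynomial.X + Polynomial.C q) := by
  induction f using MvPolynomial.induction_on with
  | C r => simp [algEquiv_C]
  | add f g hf hg => rw [map_add, map_add, map_add, hf, hg, Polynomial.map_add, Polynomial.add_comp]
  | mul_X f i hf =>
    rw [map_mul, map_mul, map_mul, hf, Polynomial.map_mul, Polynomial.mul_comp]
    congr 1
    have hq : (equivMvPolynomial k).symm (Polynomial.aeval (X 0) q) = Polynomial.C q := by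
      have : (Polynomial.aeval ((equivMvPolynomial k).symm (X 0)) : Polynomial k →ₐ[k] _) =
          (Algebra.ofId (Polynomial k) (Polynomial (Polynomial k))).restrictScalars k := by
        apply Polynomial.algHom_ext
        simp [Algebra.ofId_apply]
      have := congrArg (fun g => g q) this
      rw [Polynomial.aeval_algHom_apply] at this
      exact this
    fin_cases i
    · simp [h.1]
    · simp [h.2, hq]

open Polynomial.Bivariate in
theorem bivariate_C_eq_aeval (q : Polynomial k) :
    equivMvPolynomial k (Polynomial.C q) = Polynomial.aeval (X 0) q := by
  have : ((equivMvPolynomial k).toAlgHom.comp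
      ((Algebra.ofId (Polynomial k) (Polynomial (Polynomial k))).restrictScalars k))
        = Polynomial.aeval (X 0) := by
    apply Polynomial.algHom_ext
    simp [Algebra.ofId_apply]
  exact congrArg (fun g => g q) this

open Polynomial.Bivariate in
theorem bivariate_map_C_eq_aeval (q : Polynomial k) :
    equivMvPolynomial k (q.map Polynomial.C) = Polynomial.aeval (X 1) q := by
  have : (equivMvPolynomial k).toAlgHom.comp (Polynomial.mapAlgHom (Algebra.ofId k (Polynomial k)))
        = Polynomial.aeval (X 1) := by
    apply Polynomial.algHom_ext
    simp
  exact congrArg (fun g => g q) this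

theorem Polynomial.coeff_C_mul_X_comp (F : Polynomial k) (a : k) (i : ℕ) :
    (F.comp (Polynomial.C a * Polynomial.X)).coeff i = F.coeff i * a ^ i :=
  Polynomial.comp_C_mul_X_coeff

open Polynomial.Bivariate in
/-- Semi-invariants of `x ↦ a x`, `y ↦ y + q(x)` of weight `a` do not involve `y` if `q(0) ≠ 0`. -/
theorem IsTriangular.exists_aeval_X_zero [CharZero k]
    {ρ : MvPolynomial (Fin 2) k ≃ₐ[k] MvPolynomial (Fin 2) k} {a : k} {q : Polynomial k}
    (ha : a ≠ 0) (h : IsTriangular ρ a 0 1 q) (hq : q.coeff 0 ≠ 0) {f : MvPolynomial (Fin 2) k}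
    (hf : ρ f = C a * f) : ∃ p : Polynomial k, f = Polynomial.aeval (X 0) p := by
  set F := (equivMvPolynomial k).symm f with hF
  have hact := h.bivariate_apply f
  rw [hf, map_mul, equivMvPolynomial_symm_C, ← hF, Polynomial.C_0, add_zero, Polynomial.C_1,
    Polynomial.C_1, one_mul, ← Polynomial.taylor_apply] at hact
  set P := F.map (Polynomial.compRingHom (Polynomial.C a * Polynomial.X)) with hP
  have hPc : ∀ j i, (P.coeff j).coeff i = (F.coeff j).coeff i * a ^ i := by
    intro j i
    rw [hP, Polynomial.coeff_map, Polynomial.coe_compRingHom_apply,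
      Polynomial.coeff_C_mul_X_comp]
  suffices hdeg : F.natDegree = 0 by
    obtain ⟨p, hp⟩ := Polynomial.natDegree_eq_zero.mp hdeg
    refine ⟨p, ?_⟩
    rw [← bivariate_C_eq_aeval, hp, hF, AlgEquiv.apply_symm_apply]
  by_contra hdeg
  obtain ⟨J, hJ⟩ : ∃ J, F.natDegree = J + 1 := Nat.exists_eq_succ_of_ne_zero hdeg
  have hPdeg : P.natDegree ≤ J + 1 := hJ ▸ Polynomial.natDegree_map_le
  have htop : ∀ m, J + 1 < m → P.coeff m = 0 := fun m hm =>
    Polynomial.coeff_eq_zero_of_natDegree_lt (hPdeg.trans_lt hm)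
  have h1 : Polynomial.C a * F.coeff (J + 1) = P.coeff (J + 1) := by
    have := congrArg (fun G => Polynomial.coeff G (J + 1)) hact
    simp only [Polynomial.coeff_C_mul, Polynomial.taylor_coeff] at this
    rw [this, Polynomial.eval_eq_sum_range' (n := 1)]
    · simp [Polynomial.hasseDeriv_coeff]
    · refine (Polynomial.natDegree_hasseDeriv_le _ _).trans_lt ?_
      lia
  have h2 : Polynomial.C a * F.coeff J = P.coeff J + (J + 1 : ℕ) * P.coeff (J + 1) * q := by
    have := congrArg (fun G => Polynomial.coeff G J) hact
    simp only [Polynomial.coeff_C_mul, Polynomial.taylor_coeff] at this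
    rw [this, Polynomial.eval_eq_sum_range' (n := 2)]
    · simp [Polynomial.hasseDeriv_coeff, Finset.sum_range_succ, add_comm 1 J]
    · refine (Polynomial.natDegree_hasseDeriv_le _ _).trans_lt ?_
      lia
  set L := F.coeff (J + 1) with hL
  have hL0 : L ≠ 0 := by
    rw [hL, ← hJ, Polynomial.coeff_natDegree, Polynomial.leadingCoeff_ne_zero]
    rintro h0
    rw [h0] at hJ
    simp at hJ
  set i := L.natTrailingDegree with hi
  have hLi : L.coeff i ≠ 0 := by
    rw [hi]
    exact Polynomial.trailingCoeff_eq_zero.not.mpr hL0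
  have hai : a ^ i = a := by
    have := congrArg (fun G => Polynomial.coeff G i) h1
    simp only [Polynomial.coeff_C_mul, hPc] at this
    rw [mul_comm] at this
    exact (mul_left_cancel₀ hLi this).symm
  obtain ⟨L₁, hL₁⟩ : Polynomial.X ^ i ∣ L := Polynomial.X_pow_dvd_iff.mpr fun m hm =>
    Polynomial.coeff_eq_zero_of_lt_natTrailingDegree hm
  have hLL : L.coeff i = L₁.coeff 0 := by
    rw [hL₁, Polynomial.coeff_X_pow_mul', if_pos le_rfl, Nat.sub_self]
  have h3 := congrArg (fun G => Polynomial.coeff G i) h2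
  have h4 : ((J + 1 : ℕ) : Polynomial k) * P.coeff (J + 1) * q
      = Polynomial.C ((J + 1 : ℕ) * a) * (Polynomial.X ^ i * (L₁ * q)) := by
    rw [← h1, hL₁, Polynomial.C_mul, Polynomial.C_eq_natCast]
    ring
  rw [h4] at h3
  simp only [Polynomial.coeff_C_mul, Polynomial.coeff_add, hPc, hai] at h3
  rw [Polynomial.coeff_X_pow_mul', if_pos le_rfl, Nat.sub_self, Polynomial.mul_coeff_zero,
    ← hLL] at h3
  have h5 : ((J + 1 : ℕ) : k) * a * (L.coeff i * q.coeff 0) = 0 := by linear_combination -h3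
  have hJ1 : ((J + 1 : ℕ) : k) ≠ 0 := Nat.cast_ne_zero.mpr (Nat.succ_ne_zero J)
  exact mul_ne_zero (mul_ne_zero hJ1 ha) (mul_ne_zero hLi hq) h5

open Polynomial.Bivariate in
/-- Semi-invariants of `x ↦ x + b`, `y ↦ c y` of weight `c` do not involve `x`. -/
theorem IsTriangular.exists_aeval_X_one [CharZero k]
    {ρ : MvPolynomial (Fin 2) k ≃ₐ[k] MvPolynomial (Fin 2) k} {b c : k}
    (hb : b ≠ 0) (hc : c ≠ 0) (h : IsTriangular ρ 1 b c 0) {f : MvPolynomial (Fin 2) k}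
    (hf : ρ f = C c * f) : ∃ p : Polynomial k, f = Polynomial.aeval (X 1) p := by
  set F := (equivMvPolynomial k).symm f with hF
  have hact := h.bivariate_apply f
  rw [hf, map_mul, equivMvPolynomial_symm_C, ← hF, Polynomial.C_1, one_mul, Polynomial.C_0,
    add_zero] at hact
  have hcoeff : ∀ j, (F.coeff j).natDegree = 0 := by
    intro j
    have := congrArg (fun G => Polynomial.coeff G j) hact
    simp only [Polynomial.coeff_C_mul, Polynomial.comp_C_mul_X_coeff, Polynomial.coeff_map,
      Polynomial.coe_compRingHom_apply] at this
    have hcj : c ^ j ≠ 0 := pow_ne_zero _ hc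
    apply Polynomial.natDegree_eq_zero_of_comp_X_add_C hb (c := c / c ^ j)
    have h1 : (Polynomial.C c : Polynomial k) = Polynomial.C (c / c ^ j) * Polynomial.C c ^ j := by
      rw [← Polynomial.C_pow, ← Polynomial.C_mul, div_mul_cancel₀ _ hcj]
    have h2 : (Polynomial.C c ^ j : Polynomial k) ≠ 0 :=
      pow_ne_zero _ (Polynomial.C_ne_zero.mpr hc)
    rw [h1] at this
    apply mul_right_cancel₀ h2
    rw [← h1] at this
    rw [← this]
    conv_lhs => rw [h1]
    ring
  refine ⟨F.map (Polynomial.evalRingHom 0), ?_⟩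
  rw [← bivariate_map_C_eq_aeval]
  apply (equivMvPolynomial k).symm.injective
  rw [AlgEquiv.symm_apply_apply, ← hF]
  ext1 j
  rw [Polynomial.coeff_map, Polynomial.coeff_map, Polynomial.coe_evalRingHom]
  conv_lhs => rw [Polynomial.eq_C_of_natDegree_eq_zero (hcoeff j)]
  rw [Polynomial.coeff_zero_eq_eval_zero]

theorem IsTriangular.isRigid_of_linear [CharZero k]
    {ρ : MvPolynomial (Fin 2) k ≃ₐ[k] MvPolynomial (Fin 2) k} {a c : k} {q : Polynomial k}
    (ha : a ≠ 0) (h : IsTriangular ρ a 0 c q) : IsRigid ρ := by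
  have hfix : ∀ y : k, c * y + q.coeff 0 = y → IsRigid ρ := by
    intro y hy
    apply isRigid_of_fixIdeal_ne_top
    refine fixIdeal_ne_top_of_X (aeval ![0, y]) ?_ ?_
    · rw [h.1]
      simp
    · rw [h.2, map_add, ← Polynomial.aeval_algHom_apply, map_mul, aeval_X, aeval_X]
      simp [← Polynomial.coeff_zero_eq_aeval_zero, hy]
  by_cases hc : c = 1
  · subst hc
    by_cases hq : q.coeff 0 = 0
    · exact hfix 0 (by simp [hq])
    · intro d hd hcp hρ
      obtain ⟨p, hp⟩ := h.exists_aeval_X_zero ha hq (f := d (X 0)) (by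
        rw [hρ, h.1, C_0, add_zero, ← smul_eq_C_mul, ← smul_eq_C_mul, d.map_smul])
      exact absurd hp (derivation_X_ne_aeval hd hcp 0 p)
  · have h1 : 1 - c ≠ 0 := sub_ne_zero.mpr (Ne.symm hc)
    refine hfix (q.coeff 0 / (1 - c)) ?_
    field_simp
    ring

theorem isRigid_of_mem_triangularGroup [CharZero k]
    {ρ : MvPolynomial (Fin 2) k ≃ₐ[k] MvPolynomial (Fin 2) k} (h : ρ ∈ triangularGroup k) :
    IsRigid ρ := by
  obtain ⟨a, b, c, q, ha, hc, hρ⟩ := h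
  by_cases hb : b = 0
  · subst hb
    exact hρ.isRigid_of_linear ha
  by_cases ha1 : a = 1
  · subst ha1
    obtain ⟨Q, hQ⟩ := Polynomial.exists_shift_eq hb c q
    obtain ⟨σ, hσ⟩ := exists_isTriangular (0 : k) one_ne_zero one_ne_zero Q
    obtain ⟨τ, hτ⟩ := exists_isTriangular b (one_ne_zero (α := k)) hc 0
    have hmul : τ * σ = σ * ρ := by
      refine (hτ.mul hσ).ext ?_
      convert hσ.mul hρ using 1
      · ring
      · ring
      · rw [← hQ]
        simp
    refine IsRigid.of_mul_eq hmul fun d hd hcp hcomm => ?_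
    obtain ⟨p, hp⟩ := hτ.exists_aeval_X_one hb hc (f := d (X 1)) (by
      rw [hcomm, hτ.2, map_zero, add_zero, ← smul_eq_C_mul, ← smul_eq_C_mul, d.map_smul])
    exact absurd hp (derivation_X_ne_aeval hd hcp 1 p)
  · have h1 : 1 - a ≠ 0 := sub_ne_zero.mpr (Ne.symm ha1)
    obtain ⟨σ, hσ⟩ := exists_isTriangular (b / (1 - a)) (one_ne_zero (α := k)) one_ne_zero 0
    obtain ⟨τ, hτ⟩ := exists_isTriangular 0 ha hc
      (q.comp (Polynomial.X + Polynomial.C (b / (1 - a))))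
    have hmul : τ * σ = σ * ρ := by
      refine (hτ.mul hσ).ext ?_
      convert hσ.mul hρ using 1
      · ring
      · field_simp
        ring
      · ring
      · simp
    exact (hτ.isRigid_of_linear ha).of_mul_eq hmul

theorem isRigid_affine [CharZero k]
    {ε : MvPolynomial (Fin 2) k ≃ₐ[k] MvPolynomial (Fin 2) k} (h : ε ∈ affineTriangular k) :
    IsRigid (ε * swapVariables k) := by
  obtain ⟨a, b, c, q, ha, hc, hq, hε⟩ := h
  obtain ⟨p, r, rfl⟩ : ∃ p r, q = Polynomial.C p * Polynomial.X + Polynomial.C r :=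
    ⟨_, _, Polynomial.eq_X_add_C_of_natDegree_le_one hq⟩
  have e0 : (ε * swapVariables k) (X 0) = C c * X 1 + C p * X 0 + C r := by
    rw [AlgEquiv.mul_apply, swapVariables_X_zero, hε.2]
    simp [algebraMap_eq, add_assoc]
  have e1 : (ε * swapVariables k) (X 1) = C a * X 0 + C b := by
    rw [AlgEquiv.mul_apply, swapVariables_X_one, hε.1]
  by_cases hdet : p + c * a = 1
  · obtain ⟨η, hη⟩ := exists_isTriangular (0 : k) one_ne_zero one_ne_zero
      (-(Polynomial.C c * Polynomial.X))
    obtain ⟨τ, hτ⟩ := exists_isTriangular (r + c * b) (one_ne_zero (α := k))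
      (neg_ne_zero.mpr (mul_ne_zero ha hc)) (Polynomial.C a * Polynomial.X + Polynomial.C b)
    set σ := swapVariables k * η * swapVariables k with hσ
    have hσ0 : σ (X 0) = X 0 - C c * X 1 := by
      simp only [hσ, AlgEquiv.mul_apply, swapVariables_X_zero, hη.2]
      simp [algebraMap_eq, algEquiv_C, sub_eq_add_neg]
    have hσ1 : σ (X 1) = X 1 := by
      simp only [hσ, AlgEquiv.mul_apply, swapVariables_X_one, hη.1]
      simp
    have hτ0 : τ (X 0) = X 0 + C r + C c * C b := by
      rw [hτ.1, C_add, C_mul, C_1]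
      ring
    have hτ1 : τ (X 1) = -(C a * C c) * X 1 + C a * X 0 + C b := by
      rw [hτ.2, C_neg, C_mul]
      simp [algebraMap_eq, add_assoc]
    have hp : (C p : MvPolynomial (Fin 2) k) + C c * C a = 1 := by
      rw [← C_mul, ← C_add, hdet, C_1]
    have hmul : τ * σ = σ * (ε * swapVariables k) := by
      apply algEquiv_ext_fin_two
      · rw [AlgEquiv.mul_apply, AlgEquiv.mul_apply σ, e0, hσ0]
        simp only [map_add, map_sub, map_mul, algEquiv_C, hσ0, hσ1, hτ0, hτ1]
        linear_combination (-X 0 + C c * X 1) * hp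
      · rw [AlgEquiv.mul_apply, AlgEquiv.mul_apply σ, e1, hσ1]
        simp only [map_add, map_mul, algEquiv_C, hσ0, hτ1]
        ring
    exact (isRigid_of_mem_triangularGroup ⟨_, _, _, _, one_ne_zero,
      neg_ne_zero.mpr (mul_ne_zero ha hc), hτ⟩).of_mul_eq hmul
  · have h1 : 1 - (p + c * a) ≠ 0 := sub_ne_zero.mpr (Ne.symm hdet)
    apply isRigid_of_fixIdeal_ne_top
    refine fixIdeal_ne_top_of_X (aeval ![(c * b + r) / (1 - (p + c * a)),
      a * ((c * b + r) / (1 - (p + c * a))) + b]) ?_ ?_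
    · rw [e0]
      simp
      field_simp
      ring
    · rw [e1]
      simp

theorem mendes_pan {k : Type*} [Field k] [CharZero k]
    {d : Derivation k (MvPolynomial (Fin 2) k) (MvPolynomial (Fin 2) k)} (hd : DSimple d)
    (hc : ConstPrimitive d) (ρ : MvPolynomial (Fin 2) k ≃ₐ[k] MvPolynomial (Fin 2) k)
    (hρ : ∀ f, ρ (d f) = d (ρ f)) (f : MvPolynomial (Fin 2) k) : ρ f = f := by
  have hrigid : IsRigid ρ := by
    obtain ⟨n, hn⟩ := exists_isWord ρ
    rcases hn.reduce affineTriangular_subset swap_mul_affine_mul_swap with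
      ⟨ε, hε, h⟩ | ⟨ε, hε, h⟩ | ⟨l, hl, hlE, h⟩
    · exact (isRigid_of_mem_triangularGroup hε).of_isConj h
    · exact (isRigid_affine hε).of_isConj h
    · exact (isRigid_of_fixIdeal_ne_top (fixIdeal_henon_ne_top l hl hlE)).of_isConj h
  rw [hrigid d hd hc hρ, AlgEquiv.one_apply]

end TriangularRigidity

/-- Let `d₂` be a simple derivation of `k[x₁,x₂]` satisfying condition (i)
relative to `l` and condition (∗) for some exponent matrix `A_{d₂}`. Then any extension
`d_n = d₂ + g₂(x₂)∂_{x₃} + … + g_{n-1}(x_{n-1})∂_{x_n}` with nonconstant `g_j` and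
`deg g₂ ≤ l` is simple and its isotropy group is exactly the translations
`(x₁,…,x_{n-1}, x_n + c)`. (0-indexed variables.) -/
theorem stmt18 (k : Type*) [Field k] [CharZero k] (n : ℕ) (hn : 2 < n) (l : ℕ∞)
    (d2 : Derivation k (MvPolynomial (Fin 2) k) (MvPolynomial (Fin 2) k))
    (hsimple : ∀ I : Ideal (MvPolynomial (Fin 2) k), (∀ f ∈ I, d2 f ∈ I) → I = ⊥ ∨ I = ⊤)
    -- condition (i)
    (hd2 : ∀ (r : MvPolynomial (Fin 2) k) (g : Polynomial k),
      (g.natDegree : ℕ∞) ≤ l →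
      d2 r = Polynomial.aeval (X 1 : MvPolynomial (Fin 2) k) g →
      (∃ c : k, r = C c) ∧ g = 0)
    -- condition (ii): an exponent matrix A_{d₂} satisfying (∗)
    (A : Matrix (Fin 2) (Fin 2) ℕ) (α : Fin 2 → k) (O : Fin 2 → MvPolynomial (Fin 2) k)
    (hα : ∀ j, α j ≠ 0)
    (hA : ∀ j, d2 (X j) = C (α j) * (∏ q, X q ^ A j q) + O j)
    (hAdeg : ∀ j, (d2 (X j)).totalDegree = ∑ q, A j q)
    (hstar : ∀ t : Fin 2 → ℕ, (∀ j, ∑ q, A j q * t q ≤ t j) → t = 0)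
    -- the extension d_n
    (G : ℕ → Polynomial k)
    (hGnc : ∀ j : ℕ, 2 ≤ j → j < n → 0 < (G j).natDegree)
    (hGdeg : ((G 2).natDegree : ℕ∞) ≤ l)
    (dn : Derivation k (MvPolynomial (Fin n) k) (MvPolynomial (Fin n) k))
    (hres : ∀ j : Fin 2,
      dn (X (Fin.castLE hn.le j)) = rename (Fin.castLE hn.le) (d2 (X j)))
    (hG : ∀ (j : ℕ) (h1 : 2 ≤ j) (h2 : j < n),
      dn (X (⟨j, h2⟩ : Fin n)) = Polynomial.aeval (X (⟨j - 1, by omega⟩ : Fin n)) (G j)) :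
    (∀ I : Ideal (MvPolynomial (Fin n) k), (∀ f ∈ I, dn f ∈ I) → I = ⊥ ∨ I = ⊤) ∧
      (∀ ρ : MvPolynomial (Fin n) k ≃ₐ[k] MvPolynomial (Fin n) k,
        (∀ f, ρ (dn f) = dn (ρ f)) ↔
          ∃ c : k, (∀ j : Fin n, (j : ℕ) + 1 < n → ρ (X j) = X j) ∧
            ρ (X (⟨n - 1, by omega⟩ : Fin n)) = X (⟨n - 1, by omega⟩ : Fin n) + C c) := by
  obtain ⟨m, rfl⟩ : ∃ m, n = m + 3 := ⟨n - 3, by lia⟩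
  have hl : 1 ≤ l := by
    refine le_trans ?_ hGdeg
    exact_mod_cast hGnc 2 le_rfl (by lia)
  have hconst : ConstPrimitive d2 := by
    intro f c hf
    exact (hd2 f (Polynomial.C c) (by simp) (by rw [hf, Polynomial.aeval_C])).1
  set G' : ℕ → Polynomial k := fun j => if j < m + 3 then G j else Polynomial.X with hG'
  have hG'j : ∀ j, j < m + 3 → G' j = G j := fun j hj => if_pos hj
  have hGpos : ∀ j, 2 ≤ j → 0 < (G' j).natDegree := by
    intro j hj
    by_cases hjm : j < m + 3
    · rw [hG'j j hjm]; exact hGnc j hj hjm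
    · rw [hG']; simp [hjm]
  have h0 : NoPrimitive d2 (Polynomial.aeval (X 1) (G' 2)) := by
    rw [hG'j 2 (by lia)]
    intro r c c' hr
    have hGd := hGnc 2 le_rfl (by lia)
    obtain ⟨h1, h2⟩ := hd2 r (Polynomial.C c * G 2 + Polynomial.C c') (by
      refine le_trans ?_ hGdeg
      rw [Polynomial.natDegree_add_C]
      exact_mod_cast Polynomial.natDegree_C_mul_le c (G 2)) (by rw [hr]; simp)
    have hc : c = 0 := by
      by_contra hc
      have : (Polynomial.C c * G 2 + Polynomial.C c').natDegree = (G 2).natDegree := by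
        rw [Polynomial.natDegree_add_C, Polynomial.natDegree_C_mul hc]
      rw [h2] at this
      simp at this; lia
    exact ⟨hc, by simpa [hc] using h2, h1⟩
  have hdn : dn = towerDer d2 G' (m + 1) := by
    apply derivation_ext
    intro i
    by_cases hi : (i : ℕ) < 2
    · have h1 := hres ⟨i, hi⟩
      have h2 := towerDer_castLE d2 G' (m + 1) (X ⟨i, hi⟩)
      rw [rename_X] at h2
      exact h1.trans h2
    · rw [show i = ⟨i, i.2⟩ from rfl, hG i (by lia) i.2, towerDer_X _ _ _ _ (by lia),
        hG'j i i.2]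
  subst hdn
  exact ⟨towerDer_simple hsimple h0 hGpos (m + 1), fun ρ =>
    isotropy_tower hsimple hconst h0 hGpos (fun ρ hρ => mendes_pan hsimple hconst ρ hρ) m ρ⟩
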